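/- arXiv:2110.10856 — 3 statements merged into one kernel-verified Lean document; each statement's English description precedes it below -/
import Mathlib

section
/- Fix 1 ≤ k ≤ n−2 and Z ∈ Mat^{>0}_{n,k+2} with rows Z_1,…,Z_n; set Ẑ_1 := (−1)^{k+1} Z_1. Define F° := {Y ∈ Gr_{k,k+2} : ⟨Y Z_i Z_{i+1}⟩ > 0 for 1 ≤ i ≤ n−1, ⟨Y Z_n Ẑ_1⟩ > 0, and var(⟨Y Z_1 Z_2⟩, ⟨Y Z_1 Z_3⟩, …, ⟨Y Z_1 Z_n⟩) = k}. Then the amplituhedron A_{n,k,2}(Z) equals the closure of F° in Gr_{k,k+2}. -/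
noncomputable section

/-- The Pluecker coordinate of the full-rank `k x n` matrix `C` on the column set `S`
(the minor on the columns in `S`, taken in increasing order). -/
def pluck {k n : ℕ} (C : Matrix (Fin k) (Fin n) ℝ) (S : Finset (Fin n))
    (h : S.card = k) : ℝ :=
  (C.submatrix id (fun t => ((S.orderIsoOfFin h) t).val)).det

/-- `signChanges v` is `var(v)`: the number of sign changes in the sequence
`v 0, ..., v (n-1)`, ignoring zero entries. -/
def signChanges {n : ℕ} (v : Fin n → ℝ) : ℕ :=
  sSup {m | ∃ f : Fin (m + 1) → Fin n, StrictMono f ∧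
    ∀ j : Fin m, v (f j.castSucc) * v (f j.succ) < 0}

/-- All maximal (`p x p`) minors of the `n x p` matrix `Z` are positive. -/
def posMaxMinors {n p : ℕ} (Z : Matrix (Fin n) (Fin p) ℝ) : Prop :=
  ∀ (S : Finset (Fin n)) (h : S.card = p),
    0 < (Z.submatrix (fun t => ((S.orderIsoOfFin h) t).val) id).det

/-- Twistor-type determinant: the determinant of the square matrix whose first
`k` rows are the rows of `Y` and whose last `m` rows are `u 0, ..., u (m-1)`. -/
def twist {k m : ℕ} (Y : Matrix (Fin k) (Fin (k + m)) ℝ)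
    (u : Fin m → Fin (k + m) → ℝ) : ℝ :=
  (Matrix.of (Fin.append (fun i => Y i) u)).det

/-- Full-rank `k x n` real matrices (those with linearly independent rows). -/
def FullRk (k n : ℕ) : Type :=
  {C : Matrix (Fin k) (Fin n) ℝ // LinearIndependent ℝ (fun i => C i)}

instance (k n : ℕ) : TopologicalSpace (FullRk k n) :=
  inferInstanceAs (TopologicalSpace
    {C : Matrix (Fin k) (Fin n) ℝ // LinearIndependent ℝ (fun i => C i)})

/-- Two full-rank matrices are equivalent iff they have the same row span. -/
def grSetoid (k n : ℕ) : Setoid (FullRk k n) :=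
  ⟨fun C D => Submodule.span ℝ (Set.range (fun i => C.1 i)) =
      Submodule.span ℝ (Set.range (fun i => D.1 i)),
    ⟨fun _ => rfl, fun h => h.symm, fun h1 h2 => h1.trans h2⟩⟩

/-- The real Grassmannian `Gr_{k,n}`: full-rank `k x n` matrices modulo row
operations, equipped with the quotient topology. -/
def Gr (k n : ℕ) : Type := Quotient (grSetoid k n)

instance (k n : ℕ) : TopologicalSpace (Gr k n) :=
  inferInstanceAs (TopologicalSpace (Quotient (grSetoid k n)))

/-- The point of `Gr k n` represented by the full-rank matrix `C`. -/
def grMk {k n : ℕ} (C : Matrix (Fin k) (Fin n) ℝ)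
    (h : LinearIndependent ℝ (fun i => C i)) : Gr k n :=
  Quotient.mk (grSetoid k n) ⟨C, h⟩

open Finset in
/-- A permutation-summed form of the Cauchy–Binet formula. -/
lemma factorial_mul_det_mul {p n : ℕ} (D : Matrix (Fin p) (Fin n) ℝ)
    (Z : Matrix (Fin n) (Fin p) ℝ) :
    (p.factorial : ℝ) * (D * Z).det =
      ∑ r : Fin p → Fin n, (D.submatrix id r).det * (Z.submatrix r id).det := by
  have h1 : (D * Z).det = ∑ r : Fin p → Fin n, (∏ a, D a (r a)) * (Z.submatrix r id).det := by
    have h2 : (D * Z) = fun a => ∑ j, D a j • Z j := by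
      ext a b
      simp [Matrix.mul_apply, Finset.sum_apply]
    have h3 := (Matrix.detRowAlternating (R := ℝ) (n := Fin p)).toMultilinearMap.map_sum
      (fun a (j : Fin n) => D a j • Z j)
    have h4 : (D * Z).det = (Matrix.detRowAlternating (R := ℝ) (n := Fin p)).toMultilinearMap
      (fun a => ∑ j, D a j • Z j) := by
      rw [h2]; rfl
    rw [h4, h3]
    refine Finset.sum_congr rfl fun r _ => ?_
    rw [MultilinearMap.map_smul_univ]
    rfl
  have h5 : ∀ σ : Equiv.Perm (Fin p), (D * Z).det = ∑ r : Fin p → Fin n,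
      ((Equiv.Perm.sign σ : ℤ) : ℝ) * (∏ a, D (σ a) (r a)) * (Z.submatrix r id).det := by
    intro σ
    rw [h1]
    refine Fintype.sum_equiv (σ.arrowCongr (Equiv.refl _)).symm _ _ fun r => ?_
    have h6 : (Z.submatrix (r ∘ σ) id).det =
        ((Equiv.Perm.sign σ : ℤ) : ℝ) * (Z.submatrix r id).det := by
      have := Matrix.det_permute σ (Z.submatrix r id)
      rw [← this]; rfl
    have h7 : (σ.arrowCongr (Equiv.refl (Fin n))).symm r = r ∘ σ := by
      ext a; simp [Equiv.arrowCongr]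
    have h8 : ((Equiv.Perm.sign σ : ℤ) : ℝ) * ((Equiv.Perm.sign σ : ℤ) : ℝ) = 1 := by
      norm_cast
      simp
    rw [h7, h6, ← Equiv.prod_comp σ (fun a => D a (r a))]
    simp only [Function.comp]
    linear_combination (-(∏ a, D (σ a) (r (σ a))) * (Z.submatrix r id).det) * h8
  have h9 : (p.factorial : ℝ) * (D * Z).det = ∑ _σ : Equiv.Perm (Fin p), (D * Z).det := by
    simp [Fintype.card_perm]
  rw [h9, Finset.sum_congr rfl fun σ _ => h5 σ, Finset.sum_comm]
  refine Finset.sum_congr rfl fun r _ => ?_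
  rw [← Finset.sum_mul, Matrix.det_apply' (D.submatrix id r)]
  rfl

/-- An injective map from `Fin p` can be sorted by a permutation. -/
lemma exists_perm_strictMono {p n : ℕ} {r : Fin p → Fin n} (hr : Function.Injective r) :
    ∃ σ : Equiv.Perm (Fin p), StrictMono (r ∘ σ) :=
  ⟨Tuple.sort r, (Tuple.monotone_sort r).strictMono_of_injective
    (hr.comp (Equiv.injective _))⟩

/-- If the maximal minors of `D` are nonnegative and not all zero, and those of `Z` are positive,
then `D * Z` has positive determinant. -/
lemma det_mul_pos {p n : ℕ} {D : Matrix (Fin p) (Fin n) ℝ} {Z : Matrix (Fin n) (Fin p) ℝ}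
    (hD : ∀ f : Fin p → Fin n, StrictMono f → 0 ≤ (D.submatrix id f).det)
    (hZ : ∀ f : Fin p → Fin n, StrictMono f → 0 < (Z.submatrix f id).det)
    (f : Fin p → Fin n) (hf : StrictMono f) (hDf : 0 < (D.submatrix id f).det) :
    0 < (D * Z).det := by
  have h1 : 0 < (p.factorial : ℝ) * (D * Z).det := by
    rw [factorial_mul_det_mul]
    refine Finset.sum_pos' (fun r _ => ?_) ⟨f, Finset.mem_univ _, mul_pos hDf (hZ f hf)⟩
    by_cases hr : Function.Injective r
    · obtain ⟨σ, hσ⟩ := exists_perm_strictMono hr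
      have h8 : ((Equiv.Perm.sign σ : ℤ) : ℝ) * ((Equiv.Perm.sign σ : ℤ) : ℝ) = 1 := by
        norm_cast
        simp
      have e1 : (D.submatrix id (r ∘ σ)).det =
          ((Equiv.Perm.sign σ : ℤ) : ℝ) * (D.submatrix id r).det := by
        rw [← Matrix.det_permute' σ (D.submatrix id r)]; rfl
      have e2 : (Z.submatrix (r ∘ σ) id).det =
          ((Equiv.Perm.sign σ : ℤ) : ℝ) * (Z.submatrix r id).det := by
        rw [← Matrix.det_permute σ (Z.submatrix r id)]; rfl
      have h9 := mul_nonneg (hD _ hσ) (hZ _ hσ).le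
      rw [e1, e2] at h9
      calc (0 : ℝ) ≤ _ := h9
        _ = _ := by linear_combination ((D.submatrix id r).det * (Z.submatrix r id).det) * h8
    · simp only [Function.Injective, not_forall] at hr
      obtain ⟨a, b, hab, hne⟩ := hr
      rw [Matrix.det_zero_of_column_eq hne (fun i => by simp [hab])]
      simp
  exact pos_of_mul_pos_right h1 (by positivity)

/-- A vector in the row span of a totally positive `p × n` matrix cannot weakly alternate at
`p + 1` places without vanishing there. -/
lemma eq_zero_of_alternating {p n : ℕ} {C : Matrix (Fin p) (Fin n) ℝ}
    (hC : ∀ f : Fin p → Fin n, StrictMono f → 0 < (C.submatrix id f).det)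
    (x : Fin p → ℝ) (f : Fin (p + 1) → Fin n) (hf : StrictMono f)
    (hx : ∀ a : Fin (p + 1), 0 ≤ (-1 : ℝ) ^ (a : ℕ) * (Matrix.vecMul x C) (f a)) (a : Fin (p + 1)) :
    (Matrix.vecMul x C) (f a) = 0 := by
  set v := Matrix.vecMul x C with hv
  let M : Matrix (Fin (p + 1)) (Fin (p + 1)) ℝ :=
    Matrix.of (Fin.cons (fun b => v (f b)) (fun i b => C i (f b)))
  have hM : M.det = 0 := by
    apply Matrix.exists_vecMul_eq_zero_iff.mp
    refine ⟨Fin.cons (-1) x, fun h => ?_, ?_⟩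
    · have := congrFun h 0
      simp at this
    · ext b
      simp [Matrix.vecMul, dotProduct, Fin.sum_univ_succ, M, hv]
  rw [Matrix.det_succ_row_zero] at hM
  have hsub : ∀ b : Fin (p + 1), 0 < (M.submatrix Fin.succ b.succAbove).det := fun b =>
    hC (f ∘ b.succAbove) (hf.comp (Fin.strictMono_succAbove b))
  have hz := (Finset.sum_eq_zero_iff_of_nonneg (fun b _ => by
    exact mul_nonneg (hx b) (hsub b).le)).mp hM a (Finset.mem_univ _)
  have := hsub a
  have h0 : M 0 a = v (f a) := rfl
  rw [h0] at hz
  simpa [this.ne'] using hz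
/-- A nonzero sequence splits into blocks of weakly constant, alternating sign, the number of
blocks being the length of a strictly alternating subsequence. The block of `j` is `b j`. -/
lemma exists_sign_blocks (w : ℕ → ℝ) (N : ℕ) :
    (∀ j < N, w j = 0) ∨ ∃ (s : ℝ) (c : ℕ) (b f : ℕ → ℕ), b 0 = 0 ∧
      (∀ j, b j ≤ b (j + 1) ∧ b (j + 1) ≤ b j + 1) ∧ (∀ j, b j ≤ c) ∧
      (∀ j < N, 0 ≤ s * (-1) ^ (b j) * w j) ∧
      (∀ a < c, f a < f (a + 1)) ∧ (∀ a ≤ c, f a < N ∧ 0 < s * (-1) ^ a * w (f a)) ∧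
      (∀ j, N ≤ j + 1 → b j = c) := by
  induction N with
  | zero => left; intro j hj; omega
  | succ N ih =>
    rcases ih with h0 | ⟨s, c, b, f, hb0, hb1, hbc, hbs, hf1, hf2, hbN⟩
    · by_cases hw : w N = 0
      · left
        intro j hj
        rcases Nat.lt_succ_iff_lt_or_eq.mp hj with h | rfl
        · exact h0 j h
        · exact hw
      · right
        refine ⟨w N, 0, fun _ => 0, fun _ => N, rfl, by simp, by simp, ?_, by simp, ?_, by simp⟩
        · intro j hj
          rcases Nat.lt_succ_iff_lt_or_eq.mp hj with h | rfl
          · simp [h0 j h]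
          · simpa using mul_self_nonneg _
        · intro a ha
          obtain rfl : a = 0 := by omega
          simpa using mul_self_pos.mpr hw
    · right
      have hNpos : 0 < N := lt_of_le_of_lt (Nat.zero_le _) (hf2 0 (Nat.zero_le _)).1
      by_cases hw : 0 ≤ s * (-1) ^ c * w N
      · refine ⟨s, c, b, f, hb0, hb1, hbc, ?_, hf1, ?_, fun j hj => hbN j (by omega)⟩
        · intro j hj
          rcases Nat.lt_succ_iff_lt_or_eq.mp hj with h | rfl
          · exact hbs j h
          · rw [hbN j (by omega)]; exact hw
        · intro a ha
          exact ⟨(hf2 a ha).1.trans (Nat.lt_succ_self _), (hf2 a ha).2⟩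
      · refine ⟨s, c + 1, fun j => if j < N then b j else c + 1,
          fun a => if a ≤ c then f a else N, ?_, ?_, ?_, ?_, ?_, ?_, ?_⟩
        · simp [hNpos, hb0]
        · intro j
          have h1 := hb1 j
          have h2 := hbc j
          have h3 := hbN j
          dsimp only
          split_ifs <;> omega
        · intro j
          have h2 := hbc j
          dsimp only
          split_ifs <;> omega
        · intro j hj
          dsimp only
          split_ifs with h
          · exact hbs j h
          · obtain rfl : j = N := by omega
            rw [pow_succ]; linarith
        · intro a ha
          dsimp only
          rw [if_pos (by omega : a ≤ c)]
          split_ifs with h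
          · exact hf1 a (by omega)
          · exact (hf2 a (by omega)).1
        · intro a ha
          dsimp only
          split_ifs with h
          · exact ⟨(hf2 a h).1.trans (Nat.lt_succ_self _), (hf2 a h).2⟩
          · obtain rfl : a = c + 1 := by omega
            refine ⟨Nat.lt_succ_self _, ?_⟩
            rw [pow_succ]; linarith
        · intro j hj
          dsimp only
          rw [if_neg (by omega)]

/-- Merging consecutive blocks of columns of a totally positive matrix, with nonnegative weights
not all zero on each block, gives a matrix of positive determinant. -/
lemma det_merge_pos {p n : ℕ} {C : Matrix (Fin p) (Fin n) ℝ}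
    (hC : ∀ f : Fin p → Fin n, StrictMono f → 0 < (C.submatrix id f).det)
    (b : Fin n → ℕ) (hb : Monotone b) (t : Fin n → ℝ) (ht : ∀ j, 0 ≤ t j)
    (htp : ∀ i : Fin p, ∃ j, b j = i ∧ 0 < t j) :
    0 < (Matrix.of fun i : Fin p => ∑ j with b j = i, t j • C.transpose j).det := by
  have h3 := (Matrix.detRowAlternating (R := ℝ) (n := Fin p)).toMultilinearMap.map_sum_finset
    (fun a (j : Fin n) => t j • C.transpose j)
    (fun i : Fin p => Finset.univ.filter fun j => b j = i)
  have h4 : (Matrix.of fun i : Fin p => ∑ j with b j = i, t j • C.transpose j).det =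
      (Matrix.detRowAlternating (R := ℝ) (n := Fin p)).toMultilinearMap
        (fun i => ∑ j with b j = i, t j • C.transpose j) := rfl
  rw [h4, h3]
  have key : ∀ r ∈ Fintype.piFinset (fun i : Fin p => Finset.univ.filter fun j => b j = i),
      0 < (C.transpose.submatrix r id).det := by
    intro r hr
    rw [← Matrix.det_transpose]
    refine hC r fun i j hij => ?_
    rw [Fintype.mem_piFinset] at hr
    have hi := hr i
    have hj := hr j
    simp only [Finset.mem_filter, Finset.mem_univ, true_and] at hi hj
    by_contra hcon
    have := hb (not_lt.mp hcon)
    have : (i : ℕ) < j := hij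
    omega
  choose g hg1 hg2 using htp
  have hval : ∀ r : Fin p → Fin n, (Matrix.detRowAlternating (R := ℝ) (n := Fin p)).toMultilinearMap
      (fun i => t (r i) • C.transpose (r i)) =
        (∏ i, t (r i)) * (C.transpose.submatrix r id).det := by
    intro r
    rw [MultilinearMap.map_smul_univ]
    rfl
  refine Finset.sum_pos' (fun r hr => ?_) ⟨g, ?_, ?_⟩
  · rw [hval]
    exact mul_nonneg (Finset.prod_nonneg fun i _ => ht _) (key r hr).le
  · simp [hg1]
  · rw [hval]
    exact mul_pos (Finset.prod_pos fun i _ => hg2 _) (key g (by simp [hg1]))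

/-- A nonzero vector orthogonal to the rows of a totally positive `p × n` matrix has at least
`p` sign changes. -/
lemma exists_alternating {p n : ℕ} (hpn : p ≤ n) {C : Matrix (Fin p) (Fin n) ℝ}
    (hC : ∀ f : Fin p → Fin n, StrictMono f → 0 < (C.submatrix id f).det)
    (w : Fin n → ℝ) (hw : w ≠ 0) (hCw : C.mulVec w = 0) :
    ∃ (s : ℝ) (f : Fin (p + 1) → Fin n), StrictMono f ∧
      ∀ a : Fin (p + 1), 0 < s * (-1) ^ (a : ℕ) * w (f a) := by
  obtain h0 | ⟨s, c, b, f, hb0, hb1, hbc, hbs, hf1, hf2, -⟩ :=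
    exists_sign_blocks (fun j => if h : j < n then w ⟨j, h⟩ else 0) n
  · exact absurd (funext fun j => by simpa using h0 j j.2) hw
  rcases Nat.lt_or_ge c p with hcp | hcp
  swap
  · have hf1' : ∀ a a', a < a' → a' ≤ c → f a < f a' := by
      intro a a' h
      induction a', h using Nat.le_induction with
      | base => intro h; exact hf1 a (by omega)
      | succ m hm ih => intro h; exact (ih (by omega)).trans (hf1 m (by omega))
    refine ⟨s, fun a => ⟨f a, (hf2 a (by have := a.2; omega)).1⟩, fun a a' h => ?_, fun a => ?_⟩
    · exact hf1' a a' h (by have := a'.2; omega)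
    · have := hf2 a (by have := a.2; omega)
      simpa [this.1] using this.2
  exfalso
  have hs : s ≠ 0 := by
    rintro rfl
    have := (hf2 0 (Nat.zero_le _)).2
    simp at this
  have hbm : Monotone b := monotone_nat_of_le_succ fun j => (hb1 j).1
  let b' : ℕ → ℕ := fun j => max (b j) (j - (n - p))
  have hb'm : Monotone b' := fun i j h => max_le_max (hbm h) (Nat.sub_le_sub_right h _)
  have hb'1 : ∀ j, b' (j + 1) ≤ b' j + 1 := by
    intro j
    have := (hb1 j).2
    simp only [b']
    omega
  have hb'0 : b' 0 = 0 := by simp [b', hb0]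
  have hsurj : ∀ i : ℕ, i < p → ∃ j < n, b' j = i := by
    intro i hi
    have hex : ∃ j, i ≤ b' j := ⟨n - 1, by simp only [b']; omega⟩
    refine ⟨Nat.find hex, ?_, ?_⟩
    · have : Nat.find hex ≤ n - 1 := Nat.find_min' hex (by simp only [b']; omega)
      omega
    · have h1 := Nat.find_spec hex
      rcases h : Nat.find hex with _ | m
      · rw [h] at h1; omega
      · have h2 := Nat.find_min hex (m := m) (by omega)
        rw [h] at h1
        have := hb'1 m
        omega
  have hfib : ∀ i j, b' i = b' j → i < j → b i = b j := by
    intro i j h hij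
    have := hbm hij.le
    simp only [b'] at h
    omega
  -- weights: `|w|` on blocks where `w` is not identically zero, and `1` elsewhere
  let Null : ℕ → Prop := fun i => ∀ j : Fin n, b' j = i → w j = 0
  classical
  let t : Fin n → ℝ := fun j => if Null (b' j) then 1 else |w j|
  have hsign : ∀ i : ℕ, ∃ e : ℝ, ∀ j : Fin n, b' j = i → w j = e * t j ∧ (e = 0 ↔ Null i) := by
    intro i
    by_cases hN : Null i
    · refine ⟨0, fun j hj => ⟨by simpa using hN j hj, by simp [hN]⟩⟩
    · have hN' := hN
      simp only [Null, not_forall] at hN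
      obtain ⟨j₀, hj₀, hw₀⟩ := hN
      refine ⟨if 0 < s * (-1) ^ (b j₀) then 1 else -1, fun j hj => ⟨?_, ?_⟩⟩
      · have hbj : b j = b j₀ := by
          rcases lt_trichotomy (j : ℕ) j₀ with h | h | h
          · exact hfib _ _ (hj.trans hj₀.symm) h
          · rw [h]
          · exact (hfib _ _ (hj₀.trans hj.symm) h).symm
        have h1 := hbs j j.2
        rw [hbj] at h1
        simp only [Fin.is_lt, dite_true, Fin.eta] at h1
        have ht : t j = |w j| := by simp only [t, hj, hN', if_false]
        rw [ht]
        have hne : s * (-1) ^ (b j₀) ≠ 0 := mul_ne_zero hs (by simp)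
        rcases lt_or_gt_of_ne hne with h | h
        · rw [if_neg h.not_gt]
          have : w j ≤ 0 := by
            by_contra hc
            nlinarith [mul_neg_of_neg_of_pos h (not_le.mp hc)]
          rw [abs_of_nonpos this]; simp
        · rw [if_pos h]
          have : 0 ≤ w j := by
            by_contra hc
            nlinarith [mul_neg_of_pos_of_neg h (not_le.mp hc)]
          rw [abs_of_nonneg this]; simp
      · simp only [hN', iff_false]
        split_ifs <;> norm_num
  choose e he using hsign
  have hdet := det_merge_pos hC (fun j => b' j) (fun i j h => hb'm h) t
    (fun j => by simp only [t]; split_ifs <;> positivity) (by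
      intro i
      by_cases hN : Null i
      · obtain ⟨j, hj, hji⟩ := hsurj i i.2
        exact ⟨⟨j, hj⟩, hji, by simp [t, hji, hN]⟩
      · have hN' := hN
        simp only [Null, not_forall] at hN'
        obtain ⟨j, hj, hwj⟩ := hN'
        exact ⟨j, hj, by simp only [t, hj, hN, if_false]; positivity⟩)
  have hker : Matrix.vecMul (fun i : Fin p => e i)
      (Matrix.of fun i : Fin p => ∑ j ∈ Finset.univ.filter (fun j : Fin n => b' j = i),
        t j • C.transpose j) = 0 := by
    ext a
    have h1 := congrFun hCw a
    simp only [Matrix.mulVec, dotProduct, Pi.zero_apply] at h1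
    simp only [Matrix.vecMul, dotProduct, Matrix.of_apply, Finset.sum_apply, Pi.smul_apply,
      Matrix.transpose_apply, smul_eq_mul, Pi.zero_apply]
    rw [← h1]
    have hlt : ∀ j : Fin n, b' j < p := by
      intro j
      have := hbc j
      have := j.2
      simp only [b']
      omega
    rw [← Finset.sum_fiberwise (s := Finset.univ) (g := fun j : Fin n => (⟨b' j, hlt j⟩ : Fin p))]
    refine Finset.sum_congr rfl fun i _ => ?_
    rw [Finset.mul_sum]
    refine Finset.sum_congr ?_ fun j hj => ?_
    · ext j
      simp [Fin.ext_iff]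
    · simp only [Finset.mem_filter, Finset.mem_univ, true_and, Fin.ext_iff] at hj
      rw [(he i j hj).1]
      ring
  have h0 := Matrix.exists_vecMul_eq_zero_iff.not.mpr hdet.ne'
  push Not at h0
  refine h0 (fun i : Fin p => e i) (fun h => hw ?_) hker
  ext j
  have hlt : b' j < p := by
    have := hbc j
    have := j.2
    simp only [b']
    omega
  have := congrFun h ⟨b' j, hlt⟩
  rw [(he (b' j) j rfl).1, show e (b' j) = 0 from this]
  simp
/-- Squared distances `∑ (f (σ a) - g a)²` between sorted families are strictly minimized by the
identity permutation. -/
lemma sum_dist_sq_lt_of_ne_one {k n : ℕ} {f g : Fin k → Fin n} (hf : StrictMono f)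
    (hg : StrictMono g) {σ : Equiv.Perm (Fin k)} (hσ : σ ≠ 1) :
    ∑ a, (((f a : ℕ) : ℤ) - (g a : ℕ)).natAbs ^ 2 <
      ∑ a, (((f (σ a) : ℕ) : ℤ) - (g a : ℕ)).natAbs ^ 2 := by
  have hmono : Monovary (fun a => ((f a : ℕ) : ℤ)) (fun a => ((g a : ℕ) : ℤ)) := by
    intro i j hij
    have h1 : g i < g j := by
      rw [Fin.lt_def]
      dsimp only at hij
      omega
    have h2 := hf.monotone (hg.lt_iff_lt.mp h1).le
    rw [Fin.le_def] at h2
    dsimp only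
    omega
  have hnot : ¬ Monovary ((fun a => ((f a : ℕ) : ℤ)) ∘ σ) (fun a => ((g a : ℕ) : ℤ)) := by
    intro h
    apply hσ
    have hs : StrictMono σ := by
      intro i j hij
      have h1 := h (show ((g i : ℕ) : ℤ) < (g j : ℕ) by exact_mod_cast hg hij)
      have h2 : f (σ i) ≤ f (σ j) := by
        rw [Fin.le_def]
        dsimp only [Function.comp] at h1
        omega
      exact lt_of_le_of_ne (hf.le_iff_le.mp h2) (σ.injective.ne hij.ne)
    have h3 := (StrictMono.range_inj hs strictMono_id).mp (by simp)
    ext i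
    simp [h3]
  have hlt := hmono.sum_comp_perm_mul_lt_sum_mul_iff.mpr hnot
  have hsq := Equiv.sum_comp σ (fun a => ((f a : ℕ) : ℤ) ^ 2)
  zify
  simp only [sq_abs, sub_sq, Finset.sum_add_distrib, Finset.sum_sub_distrib, mul_assoc,
    ← Finset.mul_sum]
  linarith

open Filter Topology in
/-- The identity matrix is a limit of matrices all of whose `k × k` minors are positive. -/
lemma exists_tendsto_one_pos_minors (n k : ℕ) :
    ∃ G : ℕ → Matrix (Fin n) (Fin n) ℝ, Tendsto G atTop (𝓝 1) ∧
      ∀ m, ∀ f g : Fin k → Fin n, StrictMono f → StrictMono g →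
        0 < ((G m).submatrix f g).det := by
  let G : ℝ → Matrix (Fin n) (Fin n) ℝ := fun s =>
    Matrix.of fun i j => s ^ ((((i : ℕ) : ℤ) - (j : ℕ)).natAbs ^ 2)
  have hGc : Continuous G := by
    refine continuous_matrix fun i j => ?_
    simp only [G, Matrix.of_apply]
    fun_prop
  have hG0 : G 0 = 1 := by
    ext i j
    by_cases h : i = j
    · subst h
      simp [G]
    · have : ((i : ℕ) : ℤ) - (j : ℕ) ≠ 0 := by
        intro h'
        exact h (Fin.ext (by omega))
      simp [G, h, this]
  have hpos : ∀ᶠ s in 𝓝[>] (0 : ℝ), ∀ f g : Fin k → Fin n, StrictMono f → StrictMono g →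
      0 < ((G s).submatrix f g).det := by
    simp only [eventually_all]
    intro f g hf hg
    let E : Equiv.Perm (Fin k) → ℕ := fun σ =>
      ∑ a, (((f (σ a) : ℕ) : ℤ) - (g a : ℕ)).natAbs ^ 2
    let B : ℝ → ℝ := fun s => ∑ σ : Equiv.Perm (Fin k),
      ((Equiv.Perm.sign σ : ℤ) : ℝ) * s ^ (E σ - E 1)
    have hE : ∀ σ, σ ≠ 1 → E 1 < E σ := fun σ hσ => sum_dist_sq_lt_of_ne_one hf hg hσ
    have hB0 : B 0 = 1 := by
      simp only [B]
      rw [Finset.sum_eq_single 1]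
      · simp
      · intro σ _ hσ
        have := hE σ hσ
        rw [zero_pow (by omega), mul_zero]
      · simp
    have hBc : Continuous B := by simp only [B]; fun_prop
    have hdet : ∀ s, ((G s).submatrix f g).det = s ^ E 1 * B s := by
      intro s
      rw [Matrix.det_apply', Finset.mul_sum]
      refine Finset.sum_congr rfl fun σ _ => ?_
      have h1 : ∏ a, (G s).submatrix f g (σ a) a = s ^ E σ := by
        simp [G, E, Finset.prod_pow_eq_pow_sum]
      have h2 : E σ = E 1 + (E σ - E 1) := by
        by_cases h : σ = 1
        · simp [h]
        · have := hE σ h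
          omega
      rw [h1, h2, pow_add, Nat.add_sub_cancel_left]
      ring
    have hB : ∀ᶠ s in 𝓝 (0 : ℝ), 0 < B s := by
      refine hBc.continuousAt.eventually (lt_mem_nhds ?_)
      rw [hB0]; norm_num
    filter_upwards [nhdsWithin_le_nhds hB, self_mem_nhdsWithin] with s hs1 hs2
    rw [hdet]
    exact mul_pos (pow_pos hs2 _) hs1
  obtain ⟨u, -, hu1, hu2⟩ := exists_seq_strictAnti_tendsto (0 : ℝ)
  have hu3 : Tendsto u atTop (𝓝[>] 0) :=
    tendsto_nhdsWithin_iff.mpr ⟨hu2, Eventually.of_forall hu1⟩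
  obtain ⟨N, hN⟩ := eventually_atTop.mp (hu3.eventually hpos)
  refine ⟨fun m => G (u (m + N)), ?_, fun m => hN (m + N) (by omega)⟩
  rw [← hG0]
  exact (hGc.tendsto 0).comp (hu2.comp (tendsto_add_atTop_nat N))

lemma exists_strictMono_det_ne_zero {k n : ℕ} {C : Matrix (Fin k) (Fin n) ℝ}
    (hC : LinearIndependent ℝ (fun i => C i)) :
    ∃ f : Fin k → Fin n, StrictMono f ∧ (C.submatrix id f).det ≠ 0 := by
  by_contra hcon
  push Not at hcon
  have hall : ∀ r : Fin k → Fin n, (C.submatrix id r).det = 0 := by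
    intro r
    by_cases hr : Function.Injective r
    · obtain ⟨σ, hσ⟩ := exists_perm_strictMono hr
      have h1 := hcon _ hσ
      have h2 : (C.submatrix id (r ∘ σ)).det =
          ((Equiv.Perm.sign σ : ℤ) : ℝ) * (C.submatrix id r).det := by
        rw [← Matrix.det_permute' σ (C.submatrix id r)]; rfl
      rw [h2] at h1
      simpa using h1
    · simp only [Function.Injective, not_forall] at hr
      obtain ⟨a, b, hab, hne⟩ := hr
      exact Matrix.det_zero_of_column_eq hne (fun i => by simp [hab])
  have h0 : (C * C.transpose).det = 0 := by
    have := factorial_mul_det_mul C C.transpose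
    simp only [hall, zero_mul, Finset.sum_const_zero] at this
    exact (mul_eq_zero.mp this).resolve_left (by positivity)
  obtain ⟨v, hv, hv0⟩ := Matrix.exists_vecMul_eq_zero_iff.mpr h0
  have h1 : Matrix.vecMul v C = 0 := by
    rw [← dotProduct_self_eq_zero]
    rw [← Matrix.vecMul_vecMul] at hv0
    have h2 : dotProduct (Matrix.vecMul (Matrix.vecMul v C) C.transpose) v = 0 := by
      rw [hv0]; simp
    rwa [Matrix.vecMul_transpose, dotProduct_comm, Matrix.dotProduct_mulVec] at h2
  rw [Fintype.linearIndependent_iff] at hC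
  apply hv
  ext i
  refine hC v ?_ i
  rw [← h1]
  ext j
  simp [Matrix.vecMul, dotProduct, Finset.sum_apply]

open Filter Topology in
/-- A totally nonnegative matrix of full rank is a limit of totally positive matrices. -/
lemma exists_tendsto_pos {k n : ℕ} {C : Matrix (Fin k) (Fin n) ℝ}
    (hC : LinearIndependent ℝ (fun i => C i))
    (hC0 : ∀ f : Fin k → Fin n, StrictMono f → 0 ≤ (C.submatrix id f).det) :
    ∃ D : ℕ → Matrix (Fin k) (Fin n) ℝ, Tendsto D atTop (𝓝 C) ∧
      ∀ m, ∀ f : Fin k → Fin n, StrictMono f → 0 < ((D m).submatrix id f).det := by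
  obtain ⟨G, hG1, hG2⟩ := exists_tendsto_one_pos_minors n k
  obtain ⟨f₀, hf₀, hd⟩ := exists_strictMono_det_ne_zero hC
  refine ⟨fun m => C * G m, ?_, fun m f hf => ?_⟩
  · have hc : Continuous fun X : Matrix (Fin n) (Fin n) ℝ => C * X := by fun_prop
    have h := (hc.tendsto 1).comp hG1
    rw [Matrix.mul_one] at h
    exact h
  · have h1 : ((C * G m).submatrix id f) = C * (G m).submatrix id f := by
      ext i j; simp [Matrix.mul_apply]
    simp only [h1]
    refine det_mul_pos hC0 (fun g hg => ?_) f₀ hf₀ (lt_of_le_of_ne (hC0 f₀ hf₀) hd.symm)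
    simpa using hG2 m g f hg hf

open Filter Topology in
/-- The amplituhedron map is well defined: a totally nonnegative matrix of full rank stays of
full rank after multiplication by a matrix with positive maximal minors. -/
lemma linearIndependent_mul {k p n : ℕ} (hkp : k ≤ p) (hpn : p ≤ n)
    {C : Matrix (Fin k) (Fin n) ℝ} {Z : Matrix (Fin n) (Fin p) ℝ}
    (hZ : ∀ f : Fin p → Fin n, StrictMono f → 0 < (Z.submatrix f id).det)
    (hC : LinearIndependent ℝ (fun i => C i))
    (hC0 : ∀ f : Fin k → Fin n, StrictMono f → 0 ≤ (C.submatrix id f).det) :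
    LinearIndependent ℝ (fun i => (C * Z) i) := by
  have hvm : ∀ (m : ℕ) (M : Matrix (Fin k) (Fin m) ℝ) (v : Fin k → ℝ),
      ∑ i, v i • M i = Matrix.vecMul v M := by
    intro m M v
    ext j
    simp [Matrix.vecMul, dotProduct, Finset.sum_apply]
  rw [Fintype.linearIndependent_iff] at hC ⊢
  intro x hx
  simp only [hvm] at hx hC
  by_contra hcon
  have hv : Matrix.vecMul x C ≠ 0 := fun h => hcon (hC x h)
  obtain ⟨s, f, hf, hs⟩ := exists_alternating hpn (C := Z.transpose)
    (fun f hf => by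
      rw [← Matrix.det_transpose]
      exact hZ f hf) (Matrix.vecMul x C) hv (by
      rw [Matrix.mulVec_transpose, Matrix.vecMul_vecMul, hx])
  obtain ⟨D, hD1, hD2⟩ := exists_tendsto_pos (C := C)
    (by rw [Fintype.linearIndependent_iff]; simpa only [hvm] using hC) hC0
  have hc : Continuous fun X : Matrix (Fin k) (Fin n) ℝ => Matrix.vecMul (s • x) X := by fun_prop
  have hev : ∀ᶠ m in atTop, ∀ a : Fin (p + 1),
      0 < (-1 : ℝ) ^ (a : ℕ) * Matrix.vecMul (s • x) (D m) (f a) := by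
    rw [eventually_all]
    intro a
    have h1 := (tendsto_pi_nhds.mp ((hc.tendsto C).comp hD1) (f a)).const_mul ((-1 : ℝ) ^ (a : ℕ))
    refine h1.eventually (lt_mem_nhds ?_)
    have := hs a
    simp only [Matrix.smul_vecMul, Pi.smul_apply, smul_eq_mul]
    linarith
  obtain ⟨m, hm⟩ := hev.exists
  let ι : Fin (k + 1) → Fin (p + 1) := Fin.castLE (by omega)
  have hι : StrictMono ι := Fin.strictMono_castLE _
  have h0 := eq_zero_of_alternating (hD2 m) (s • x) (f ∘ ι) (hf.comp hι)
    (fun a => (hm (ι a)).le) 0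
  have h1 := hm (ι 0)
  simp only [Function.comp] at h0
  rw [h0] at h1
  simp at h1

lemma val_succ_lt_of_pred {n : ℕ} (i : Fin (n - 1)) : i.val + 1 < n :=
  Nat.add_lt_of_lt_sub i.isLt

lemma val_lt_of_pred {n : ℕ} (i : Fin (n - 1)) : i.val < n :=
  (Nat.lt_succ_self _).trans (val_succ_lt_of_pred i)
lemma append_pair_eq_snoc {k : ℕ} {α : Type*} (Y : Fin k → α) (a b : α) :
    (Fin.append Y ![a, b] : Fin (k + 2) → α) =
      (Fin.snoc (α := fun _ => α) (Fin.snoc (α := fun _ => α) Y a : Fin (k + 1) → α) b :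
        Fin (k + 1 + 1) → α) := by
  ext i
  refine Fin.addCases (fun i => ?_) (fun i => ?_) i
  · rw [Fin.append_left]
    have h : (Fin.castAdd 2 i : Fin (k + 1 + 1)) = (i.castSucc).castSucc := rfl
    rw [h, Fin.snoc_castSucc, Fin.snoc_castSucc]
  · rw [Fin.append_right]
    fin_cases i
    · have h : (Fin.natAdd k (0 : Fin 2) : Fin (k + 1 + 1)) = (Fin.last k).castSucc := rfl
      simp only [Fin.mk_zero, h]
      rw [Fin.snoc_castSucc, Fin.snoc_last]
      rfl
    · have h : (Fin.natAdd k (1 : Fin 2) : Fin (k + 1 + 1)) = Fin.last (k + 1) := rfl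
      simp only [Fin.mk_one, h]
      rw [Fin.snoc_last]
      rfl

/-- Adding a row at the bottom of a matrix. -/
def snocRow {m n : ℕ} (M : Matrix (Fin m) (Fin n) ℝ) (u : Fin n → ℝ) :
    Matrix (Fin (m + 1)) (Fin n) ℝ :=
  Matrix.of (Fin.snoc (α := fun _ => Fin n → ℝ) M u)

@[simp] lemma snocRow_last {m n : ℕ} (M : Matrix (Fin m) (Fin n) ℝ) (u : Fin n → ℝ) :
    snocRow M u (Fin.last m) = u :=
  Fin.snoc_last (α := fun _ => Fin n → ℝ) u M

@[simp] lemma snocRow_castSucc {m n : ℕ} (M : Matrix (Fin m) (Fin n) ℝ) (u : Fin n → ℝ)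
    (i : Fin m) : snocRow M u i.castSucc = M i :=
  Fin.snoc_castSucc (α := fun _ => Fin n → ℝ) u M i

lemma snocRow_mul {m n p : ℕ} (M : Matrix (Fin m) (Fin n) ℝ) (u : Fin n → ℝ)
    (Z : Matrix (Fin n) (Fin p) ℝ) :
    snocRow M u * Z = snocRow (M * Z) (Matrix.vecMul u Z) := by
  ext i j
  refine Fin.lastCases ?_ (fun i => ?_) i
  · rw [Matrix.mul_apply, snocRow_last, snocRow_last]; rfl
  · rw [Matrix.mul_apply, snocRow_castSucc, snocRow_castSucc]; rfl

lemma det_snocRow {m n : ℕ} (M : Matrix (Fin m) (Fin n) ℝ) (u : Fin n → ℝ)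
    (f : Fin (m + 1) → Fin n) :
    ((snocRow M u).submatrix id f).det = ∑ t : Fin (m + 1), (-1) ^ (m + (t : ℕ)) * u (f t) *
      (M.submatrix id (f ∘ t.succAbove)).det := by
  rw [Matrix.det_succ_row _ (Fin.last m)]
  refine Finset.sum_congr rfl fun t _ => ?_
  have h : ((snocRow M u).submatrix id f).submatrix (Fin.last m).succAbove t.succAbove =
      M.submatrix id (f ∘ t.succAbove) := by
    ext i j
    simp
  rw [h]
  simp

lemma twist_eq_det_snocRow {k : ℕ} (Y : Matrix (Fin k) (Fin (k + 2)) ℝ) (a b : Fin (k + 2) → ℝ) :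
    twist Y ![a, b] =
      (show Matrix (Fin (k + 2)) (Fin (k + 2)) ℝ from snocRow (snocRow Y a) b).det := by
  unfold twist
  rw [append_pair_eq_snoc]
  rfl

lemma exists_twist_eq_dotProduct {k : ℕ} (Y : Matrix (Fin k) (Fin (k + 2)) ℝ)
    (a : Fin (k + 2) → ℝ) :
    ∃ x : Fin (k + 2) → ℝ, ∀ b, twist Y ![a, b] = dotProduct b x := by
  refine ⟨fun t => (-1) ^ (k + 1 + (t : ℕ)) *
    ((snocRow Y a).submatrix id (id ∘ Fin.succAbove (n := k + 1) t)).det, fun b => ?_⟩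
  rw [twist_eq_det_snocRow]
  have := det_snocRow (snocRow Y a) b id
  rw [Matrix.submatrix_id_id] at this
  refine this.trans (Finset.sum_congr rfl fun t _ => ?_)
  simp only [id]
  ring

lemma twist_add_right {k : ℕ} (Y : Matrix (Fin k) (Fin (k + 2)) ℝ) (a b c : Fin (k + 2) → ℝ) :
    twist Y ![a, b + c] = twist Y ![a, b] + twist Y ![a, c] := by
  obtain ⟨x, hx⟩ := exists_twist_eq_dotProduct Y a
  simp [hx, add_dotProduct]

lemma twist_smul_right {k : ℕ} (Y : Matrix (Fin k) (Fin (k + 2)) ℝ) (a b : Fin (k + 2) → ℝ)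
    (r : ℝ) : twist Y ![a, r • b] = r * twist Y ![a, b] := by
  obtain ⟨x, hx⟩ := exists_twist_eq_dotProduct Y a
  simp [hx, smul_dotProduct]

lemma twist_self {k : ℕ} (Y : Matrix (Fin k) (Fin (k + 2)) ℝ) (a : Fin (k + 2) → ℝ) :
    twist Y ![a, a] = 0 := by
  rw [twist_eq_det_snocRow]
  have hne : (Fin.last k).castSucc ≠ Fin.last (k + 1) := (Fin.castSucc_lt_last _).ne
  exact Matrix.det_zero_of_row_eq hne
    ((snocRow_castSucc _ _ _).trans ((snocRow_last _ _).trans (snocRow_last _ _).symm))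

lemma twist_row {k : ℕ} (Y : Matrix (Fin k) (Fin (k + 2)) ℝ) (a : Fin (k + 2) → ℝ) (i : Fin k) :
    twist Y ![a, Y i] = 0 := by
  rw [twist_eq_det_snocRow]
  have hne : i.castSucc.castSucc ≠ Fin.last (k + 1) := (Fin.castSucc_lt_last _).ne
  exact Matrix.det_zero_of_row_eq hne
    ((snocRow_castSucc _ _ _).trans ((snocRow_castSucc _ _ _).trans (snocRow_last _ _).symm))

lemma twist_swap {k : ℕ} (Y : Matrix (Fin k) (Fin (k + 2)) ℝ) (a b : Fin (k + 2) → ℝ) :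
    twist Y ![a, b] = -twist Y ![b, a] := by
  rw [twist_eq_det_snocRow, twist_eq_det_snocRow]
  have hne : (Fin.last k).castSucc ≠ Fin.last (k + 1) := (Fin.castSucc_lt_last _).ne
  have h := Matrix.det_permute (Equiv.swap (Fin.last k).castSucc (Fin.last (k + 1)))
    (snocRow (snocRow Y b) a)
  rw [Equiv.Perm.sign_swap hne] at h
  have h2 : (snocRow (snocRow Y b) a).submatrix
      (Equiv.swap (Fin.last k).castSucc (Fin.last (k + 1))) id = snocRow (snocRow Y a) b := by
    ext i j
    rw [Matrix.submatrix_apply, id]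
    refine Fin.lastCases ?_ (fun i => Fin.lastCases ?_ (fun i => ?_) i) i
    · simp
    · simp
    · rw [Equiv.swap_apply_of_ne_of_ne]
      · simp
      · exact fun h => (Fin.castSucc_lt_last i).ne (Fin.castSucc_injective _ h)
      · exact (Fin.castSucc_lt_last _).ne
  rw [h2] at h
  simpa using h

lemma twist_of_mem_span {k : ℕ} (Y : Matrix (Fin k) (Fin (k + 2)) ℝ) (a : Fin (k + 2) → ℝ)
    {y : Fin (k + 2) → ℝ} (hy : y ∈ Submodule.span ℝ (Set.range fun i => Y i)) :
    twist Y ![a, y] = 0 := by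
  induction hy using Submodule.span_induction with
  | mem x hx => obtain ⟨i, rfl⟩ := hx; exact twist_row Y a i
  | zero => simpa using twist_smul_right Y a 0 0
  | add x y _ _ hx hy => rw [twist_add_right, hx, hy, add_zero]
  | smul r x _ hx => rw [twist_smul_right, hx, mul_zero]

/-- If `⟨Y e f⟩ ≠ 0` then `e` and `f` span a complement of the row span of `Y`. -/
lemma exists_decomposition {k : ℕ} {Y : Matrix (Fin k) (Fin (k + 2)) ℝ}
    {e f : Fin (k + 2) → ℝ} (h : twist Y ![e, f] ≠ 0) (u : Fin (k + 2) → ℝ) :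
    ∃ y ∈ Submodule.span ℝ (Set.range fun i => Y i), ∃ α β : ℝ, u = y + α • e + β • f := by
  rw [twist_eq_det_snocRow] at h
  set M : Matrix (Fin (k + 1 + 1)) (Fin (k + 2)) ℝ := snocRow (snocRow Y e) f with hM
  let v : Fin (k + 1 + 1) → ℝ := Matrix.vecMul u M⁻¹
  have hv : Matrix.vecMul v M = u := by
    simp only [v]
    rw [Matrix.vecMul_vecMul, Matrix.nonsing_inv_mul _ (isUnit_iff_ne_zero.mpr h),
      Matrix.vecMul_one]
  refine ⟨∑ i, v i.castSucc.castSucc • Y i, Submodule.sum_mem _ fun i _ =>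
    Submodule.smul_mem _ _ (Submodule.subset_span ⟨i, rfl⟩), v (Fin.last k).castSucc,
    v (Fin.last (k + 1)), ?_⟩
  rw [← hv]
  ext j
  simp [Matrix.vecMul, dotProduct, Fin.sum_univ_castSucc, hM, Finset.sum_apply]

/-- The three-term relation: the displayed combination of `e`, `u`, `u'` lies in `Y`. -/
lemma twist_combination_mem_span {k : ℕ} {Y : Matrix (Fin k) (Fin (k + 2)) ℝ}
    {e f : Fin (k + 2) → ℝ} (h : twist Y ![e, f] ≠ 0) (u u' : Fin (k + 2) → ℝ) :
    twist Y ![u, u'] • e - twist Y ![e, u'] • u + twist Y ![e, u] • u' ∈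
      Submodule.span ℝ (Set.range fun i => Y i) := by
  obtain ⟨y, hy, α, β, hu⟩ := exists_decomposition h u
  obtain ⟨y', hy', α', β', hu'⟩ := exists_decomposition h u'
  have key : ∀ (z : Fin (k + 2) → ℝ) (c d : ℝ) (t : Fin (k + 2) → ℝ),
      t ∈ Submodule.span ℝ (Set.range fun i => Y i) →
      twist Y ![z, t + c • e + d • f] = c * twist Y ![z, e] + d * twist Y ![z, f] := by
    intro z c d t ht
    simp only [twist_add_right, twist_smul_right, twist_of_mem_span Y z ht, zero_add]
  have h1 : twist Y ![e, u] = β * twist Y ![e, f] := by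
    rw [hu, key e α β y hy, twist_self]; ring
  have h2 : twist Y ![e, u'] = β' * twist Y ![e, f] := by
    rw [hu', key e α' β' y' hy', twist_self]; ring
  have h3 : twist Y ![u, f] = α * twist Y ![e, f] := by
    rw [twist_swap, hu, key f α β y hy, twist_self, twist_swap Y f e]; ring
  have h4 : twist Y ![u, u'] = (α * β' - α' * β) * twist Y ![e, f] := by
    rw [hu', key u α' β' y' hy', h3, twist_swap Y u e, h1]; ring
  have h5 : twist Y ![u, u'] • e - twist Y ![e, u'] • u + twist Y ![e, u] • u' =
      twist Y ![e, f] • (β • y' - β' • y) := by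
    rw [h4, h2, h1, hu, hu']
    ext j
    simp only [Pi.add_apply, Pi.sub_apply, Pi.smul_apply, smul_eq_mul]
    ring
  rw [h5]
  exact Submodule.smul_mem _ _ (Submodule.sub_mem _ (Submodule.smul_mem _ _ hy')
    (Submodule.smul_mem _ _ hy))
lemma det_snocRow_single {m n : ℕ} (M : Matrix (Fin m) (Fin n) ℝ) (c : ℝ)
    {f : Fin (m + 1) → Fin n} (hf : StrictMono f) (t : Fin (m + 1)) :
    ((snocRow M (Pi.single (f t) c)).submatrix id f).det = (-1) ^ (m + (t : ℕ)) * c *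
      (M.submatrix id (f ∘ t.succAbove)).det := by
  rw [det_snocRow, Finset.sum_eq_single t]
  · simp
  · intro b _ hb
    simp [hf.injective.eq_iff, hb]
  · simp

lemma det_snocRow_single_eq_zero {m n : ℕ} (M : Matrix (Fin m) (Fin n) ℝ) (c : ℝ)
    {f : Fin (m + 1) → Fin n} {j : Fin n} (hj : ∀ t, f t ≠ j) :
    ((snocRow M (Pi.single j c)).submatrix id f).det = 0 := by
  rw [det_snocRow]
  refine Finset.sum_eq_zero fun t _ => ?_
  simp [hj t]

/-- Maximal minors of the matrix obtained from `C` by adding the rows `e_i` and `c e_j` either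
vanish or are maximal minors of `C` up to an explicit sign. -/
lemma det_snocRow_pair {k n : ℕ} (C : Matrix (Fin k) (Fin n) ℝ) (c : ℝ) (i j : Fin n)
    {f : Fin (k + 1 + 1) → Fin n} (hf : StrictMono f) :
    ((snocRow (snocRow C (Pi.single i 1)) (Pi.single j c)).submatrix id f).det = 0 ∨
    ∃ (t : Fin (k + 1 + 1)) (t' : Fin (k + 1)), f t = j ∧ f (t.succAbove t') = i ∧
      ((snocRow (snocRow C (Pi.single i 1)) (Pi.single j c)).submatrix id f).det =
        (-1) ^ (k + 1 + (t : ℕ)) * c * (-1) ^ (k + (t' : ℕ)) *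
          (C.submatrix id ((f ∘ t.succAbove) ∘ t'.succAbove)).det := by
  by_cases hj : ∃ t, f t = j
  · obtain ⟨t, rfl⟩ := hj
    have hg : StrictMono (f ∘ t.succAbove) := hf.comp (Fin.strictMono_succAbove t)
    rw [det_snocRow_single _ _ hf]
    by_cases hi : ∃ t', (f ∘ t.succAbove) t' = i
    · obtain ⟨t', rfl⟩ := hi
      right
      refine ⟨t, t', rfl, rfl, ?_⟩
      rw [det_snocRow_single _ _ hg]
      ring
    · push Not at hi
      left
      rw [det_snocRow_single_eq_zero _ _ hi, mul_zero]
  · push Not at hj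
    exact Or.inl (det_snocRow_single_eq_zero _ _ hj)

lemma neg_one_pow_mul_of_even {a b : ℕ} (h : Even (a + b)) :
    (-1 : ℝ) ^ a * (-1) ^ b = 1 := by
  rw [← pow_add, h.neg_one_pow]

/-- A maximal minor of the matrix obtained from `C` by adding the rows `e_i`, `e_{i+1}` is zero or
a maximal minor of `C`; similarly for the rows `e_{n-1}`, `(-1)^{k+1} e_0`. -/
lemma det_snocRow_pair_of_adjacent {k n : ℕ} (C : Matrix (Fin k) (Fin n) ℝ) {c : ℝ} {i j : Fin n}
    (hij : ((j : ℕ) = i + 1 ∧ c = 1) ∨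
      ((j : ℕ) = 0 ∧ (i : ℕ) = n - 1 ∧ 0 < n - 1 ∧ c = (-1) ^ (k + 1)))
    {f : Fin (k + 1 + 1) → Fin n} (hf : StrictMono f) :
    ((snocRow (snocRow C (Pi.single i 1)) (Pi.single j c)).submatrix id f).det = 0 ∨
    ∃ h : Fin k → Fin n, StrictMono h ∧
      ((snocRow (snocRow C (Pi.single i 1)) (Pi.single j c)).submatrix id f).det =
        (C.submatrix id h).det := by
  rcases det_snocRow_pair C c i j hf with h | ⟨t, t', ht, ht', h⟩
  · exact Or.inl h
  right
  refine ⟨(f ∘ t.succAbove) ∘ t'.succAbove, (hf.comp (Fin.strictMono_succAbove t)).comp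
    (Fin.strictMono_succAbove t'), ?_⟩
  rw [h]
  have hsign : (-1 : ℝ) ^ (k + 1 + (t : ℕ)) * c * (-1) ^ (k + (t' : ℕ)) = 1 := by
    rcases hij with ⟨hij, rfl⟩ | ⟨hj, hi, hn, rfl⟩
    · have h1 : f (t.succAbove t') < f t := by
        rw [ht, ht', Fin.lt_def]; omega
      have h2 : t.succAbove t' < t := hf.lt_iff_lt.mp h1
      have h3 : t'.castSucc < t := by
        by_contra hcon
        rw [Fin.succAbove_of_le_castSucc _ _ (not_lt.mp hcon)] at h2
        have := (not_lt.mp hcon)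
        rw [Fin.le_def] at this
        rw [Fin.lt_def] at h2
        simp at this h2
        omega
      have h4 : (t : ℕ) = t' + 1 := by
        rw [Fin.succAbove_of_castSucc_lt _ _ h3] at ht'
        by_contra hcon
        rw [Fin.lt_def, Fin.val_castSucc] at h3
        have h5 : t'.succ < t := by
          rw [Fin.lt_def, Fin.val_succ]; omega
        have h6 := hf h5
        have h7 := hf (Fin.castSucc_lt_succ (i := t'))
        rw [ht] at h6
        rw [ht'] at h7
        rw [Fin.lt_def] at h6 h7
        omega
      rw [mul_one]
      refine neg_one_pow_mul_of_even ⟨k + t' + 1, by omega⟩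
    · have h1 : (t : ℕ) = 0 := by
        by_contra hcon
        have := hf (show (0 : Fin (k + 1 + 1)) < t from
          Fin.pos_of_ne_zero (fun h => hcon (by simp [h])))
        rw [ht, Fin.lt_def] at this
        omega
      have h2 : (t' : ℕ) = k := by
        by_contra hcon
        have h3 : t' < Fin.last k := Fin.lt_last_iff_ne_last.mpr fun h => hcon (by simp [h])
        have h4 := hf (Fin.strictMono_succAbove t h3)
        rw [ht', Fin.lt_def] at h4
        have := (f (t.succAbove (Fin.last k))).2
        omega
      rw [h1, h2, ← pow_add, ← pow_add]
      exact Even.neg_one_pow ⟨k + 1 + k, by omega⟩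
  rw [hsign, one_mul]

lemma exists_strictMono_through {k n : ℕ} (hkn : k + 2 ≤ n) {i j : Fin n}
    (hij : (j : ℕ) = i + 1 ∨ ((j : ℕ) = 0 ∧ (i : ℕ) = n - 1)) :
    ∃ f : Fin (k + 1 + 1) → Fin n, StrictMono f ∧ ∃ (t : Fin (k + 1 + 1)) (t' : Fin (k + 1)),
      f t = j ∧ f (t.succAbove t') = i := by
  rcases hij with hij | ⟨hj, hi⟩
  · have hj := j.2
    let s : ℕ := min i (n - k - 2)
    let f : Fin (k + 1 + 1) → Fin n := fun a => ⟨s + a, by have := a.2; omega⟩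
    have hf : StrictMono f := fun a b h => by
      rw [Fin.lt_def] at h ⊢
      simp only [f]; omega
    refine ⟨f, hf, ⟨j - s, by omega⟩, ⟨i - s, by omega⟩, ?_, ?_⟩
    · ext
      simp only [f]; omega
    · rw [Fin.succAbove_of_castSucc_lt]
      · ext
        simp only [f, Fin.castSucc_mk]; omega
      · rw [Fin.lt_def]
        simp only [Fin.castSucc_mk]; omega
  · let f : Fin (k + 1 + 1) → Fin n := fun a => ⟨if (a : ℕ) < k + 1 then a else n - 1, by
      have := a.2; split_ifs <;> omega⟩
    have hf : StrictMono f := fun a b h => by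
      have := b.2
      rw [Fin.lt_def] at h ⊢
      simp only [f]; split_ifs <;> omega
    refine ⟨f, hf, 0, Fin.last k, ?_, ?_⟩
    · ext
      simp [f, hj]
    · ext
      simp [f, hi]

/-- On the image of the totally positive Grassmannian the consecutive twistor coordinates are
positive. -/
lemma twist_mul_pos {k n : ℕ} (hkn : k + 2 ≤ n) {C : Matrix (Fin k) (Fin n) ℝ}
    {Z : Matrix (Fin n) (Fin (k + 2)) ℝ}
    (hZ : ∀ f : Fin (k + 2) → Fin n, StrictMono f → 0 < (Z.submatrix f id).det)
    (hC : ∀ f : Fin k → Fin n, StrictMono f → 0 < (C.submatrix id f).det) {c : ℝ} {i j : Fin n}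
    (hij : ((j : ℕ) = i + 1 ∧ c = 1) ∨
      ((j : ℕ) = 0 ∧ (i : ℕ) = n - 1 ∧ 0 < n - 1 ∧ c = (-1) ^ (k + 1))) :
    0 < twist (C * Z) ![Z i, c • Z j] := by
  have hc : c ≠ 0 := by
    rcases hij with ⟨-, rfl⟩ | ⟨-, -, -, rfl⟩
    · norm_num
    · simp
  have h1 : snocRow (snocRow (C * Z) (Z i)) (c • Z j) =
      snocRow (snocRow C (Pi.single i 1)) (Pi.single j c) * Z := by
    rw [snocRow_mul, snocRow_mul, Matrix.single_vecMul, Matrix.single_vecMul, one_smul]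
    rfl
  rw [twist_eq_det_snocRow, h1]
  obtain ⟨f, hf, t, t', ht, ht'⟩ := exists_strictMono_through (k := k) hkn (i := i) (j := j)
    (hij.imp (fun h => h.1) (fun h => ⟨h.1, h.2.1⟩))
  have hnn : ∀ f : Fin (k + 1 + 1) → Fin n, StrictMono f →
      0 ≤ ((snocRow (snocRow C (Pi.single i 1)) (Pi.single j c)).submatrix id f).det := by
    intro f hf
    rcases det_snocRow_pair_of_adjacent C hij hf with h | ⟨h, hh, he⟩
    · exact h.ge
    · rw [he]; exact (hC h hh).le
  refine det_mul_pos hnn hZ f hf (lt_of_le_of_ne (hnn f hf) ?_)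
  have hg := hf.comp (Fin.strictMono_succAbove t)
  rw [← ht, det_snocRow_single _ _ hf, ← ht',
    show f (t.succAbove t') = (f ∘ t.succAbove) t' from rfl, det_snocRow_single _ _ hg]
  have := (hC _ (hg.comp (Fin.strictMono_succAbove t'))).ne'
  exact (mul_ne_zero (mul_ne_zero (by simp) hc) (mul_ne_zero (by simp) this)).symm

lemma pos_of_consecutive_mul_neg {m : ℕ} (v : Fin (m + 1) → ℝ)
    (hv : ∀ j : Fin m, v j.castSucc * v j.succ < 0) (hm : 0 < m) (a : Fin (m + 1)) :
    0 < v 0 * (-1) ^ (a : ℕ) * v a := by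
  induction a using Fin.induction with
  | zero =>
    have h := hv ⟨0, hm⟩
    have h0 : v 0 ≠ 0 := fun h0 => by
      have : v (Fin.castSucc ⟨0, hm⟩) = 0 := h0
      rw [this] at h
      simp at h
    simpa using mul_self_pos.mpr h0
  | succ i ih =>
    have h := hv i
    simp only [Fin.val_castSucc] at ih
    rw [Fin.val_succ, pow_succ]
    have h2 := mul_pos_of_neg_of_neg (by linarith :
      (-(v 0 * (-1) ^ (i : ℕ) * v i.castSucc)) < 0) h
    have h3 : 0 < (v i.castSucc) ^ 2 := by
      have : v i.castSucc ≠ 0 := fun h0 => by simp [h0] at h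
      positivity
    have h4 : -(v 0 * (-1) ^ (i : ℕ) * v i.castSucc) * (v i.castSucc * v i.succ) =
      (v i.castSucc) ^ 2 * (v 0 * ((-1) ^ (i : ℕ) * -1) * v i.succ) := by ring
    rw [h4] at h2
    exact pos_of_mul_pos_right h2 h3.le

/-- On the image of the totally positive Grassmannian the twistor coordinates `⟨Y Z₀ Z_j⟩` have
exactly `k` sign changes. -/
lemma signChanges_twist_mul {k n : ℕ} (hk : 1 ≤ k) (hkn : k + 2 ≤ n)
    {C : Matrix (Fin k) (Fin n) ℝ} {Z : Matrix (Fin n) (Fin (k + 2)) ℝ}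
    (hZ : ∀ f : Fin (k + 2) → Fin n, StrictMono f → 0 < (Z.submatrix f id).det)
    (hC : ∀ f : Fin k → Fin n, StrictMono f → 0 < (C.submatrix id f).det) :
    signChanges (fun j : Fin (n - 1) => twist (C * Z) ![Z ⟨0, by omega⟩,
      Z ⟨j.val + 1, val_succ_lt_of_pred j⟩]) = k := by
  obtain ⟨x, hx⟩ := exists_twist_eq_dotProduct (C * Z) (Z ⟨0, by omega⟩)
  set w : Fin n → ℝ := fun j => twist (C * Z) ![Z ⟨0, by omega⟩, Z j] with hw
  have hwx : w = Matrix.vecMul x Z.transpose := by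
    ext j
    simp only [hw, hx, Matrix.vecMul_transpose, Matrix.mulVec]
  have hw0 : w ⟨0, by omega⟩ = 0 := twist_self _ _
  have hw1 : 0 < w ⟨1, by omega⟩ := by
    have := twist_mul_pos hkn hZ hC (c := 1) (i := ⟨0, by omega⟩) (j := ⟨1, by omega⟩)
      (Or.inl ⟨rfl, rfl⟩)
    simpa using this
  have hCw : C.mulVec w = 0 := by
    rw [hwx, Matrix.vecMul_transpose, Matrix.mulVec_mulVec]
    ext a
    have h1 := twist_row (C * Z) (Z ⟨0, by omega⟩) a
    rw [hx] at h1
    exact h1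
  change sSup {m | ∃ f : Fin (m + 1) → Fin (n - 1), StrictMono f ∧ ∀ j : Fin m,
    w ⟨(f j.castSucc : ℕ) + 1, _⟩ * w ⟨(f j.succ : ℕ) + 1, _⟩ < 0} = k
  refine IsGreatest.csSup_eq ⟨?_, ?_⟩
  · obtain ⟨s, f, hf, hs⟩ := exists_alternating (by omega) hC w (fun h => by simp [h] at hw1) hCw
    have hf0 : ∀ a, 0 < (f a : ℕ) := by
      intro a
      by_contra hcon
      have h1 : f a = ⟨0, by omega⟩ := Fin.ext (by simpa using hcon)
      have h2 := hs a
      rw [h1, hw0] at h2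
      simp at h2
    refine ⟨fun a => ⟨f a - 1, by have := (f a).2; have := hf0 a; omega⟩, fun a b h => ?_,
      fun j => ?_⟩
    · have h1 := hf h
      have h2 := hf0 a
      rw [Fin.lt_def] at h1 ⊢
      dsimp only
      omega
    · have e : ∀ a, (⟨(f a : ℕ) - 1 + 1, by have := (f a).2; have := hf0 a; omega⟩ : Fin n) =
          f a := fun a => Fin.ext (by have := hf0 a; dsimp only; omega)
      simp only [e]
      have h1 := hs j.castSucc
      have h2 := hs j.succ
      rw [Fin.val_succ, pow_succ] at h2
      rw [Fin.val_castSucc] at h1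
      have h3 := mul_pos h1 h2
      have h4 : 0 < (s * (-1) ^ (j : ℕ)) ^ 2 := by
        have : s * (-1) ^ (j : ℕ) ≠ 0 := fun h => by simp [h] at h1
        positivity
      have h5 : s * (-1) ^ (j : ℕ) * w (f j.castSucc) *
          (s * ((-1) ^ (j : ℕ) * -1) * w (f j.succ)) =
          (s * (-1) ^ (j : ℕ)) ^ 2 * (-(w (f j.castSucc) * w (f j.succ))) := by ring
      rw [h5] at h3
      have := pos_of_mul_pos_right h3 h4.le
      linarith
  · rintro m ⟨f, hf, hneg⟩
    by_contra hcon
    have hkm : k + 1 ≤ m := by omega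
    let g : Fin (m + 1) → Fin n := fun a => ⟨(f a : ℕ) + 1, by have := (f a).2; omega⟩
    have hg : StrictMono g := fun a b h => by
      have := hf h
      rw [Fin.lt_def] at this ⊢
      simp only [g]; omega
    have hpos := pos_of_consecutive_mul_neg (fun a => w (g a)) hneg (by omega)
    let ι : Fin (k + 2) → Fin (m + 1) := Fin.castLE (by omega)
    let F : Fin (k + 2 + 1) → Fin n := Fin.cons ⟨0, by omega⟩ (g ∘ ι)
    have hF : StrictMono F := by
      refine Fin.strictMono_iff_lt_succ.mpr fun a => ?_
      refine Fin.cases ?_ (fun a => ?_) a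
      · simp only [F, Fin.castSucc_zero, Fin.cons_zero, Fin.cons_succ, g, Function.comp,
          Fin.lt_def]
        omega
      · rw [← Fin.succ_castSucc]
        simp only [F, Fin.cons_succ]
        exact hg (Fin.strictMono_castLE _ Fin.castSucc_lt_succ)
    have h0 := eq_zero_of_alternating (C := Z.transpose) (p := k + 2) (fun f hf => by
      rw [← Matrix.det_transpose]; exact hZ f hf) ((-(w (g 0))) • x) F hF (fun a => by
        rw [Matrix.smul_vecMul, ← hwx]
        refine Fin.cases ?_ (fun a => ?_) a
        · simp [F, hw0]
        · have := hpos (ι a)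
          have e : ((ι a : Fin (m + 1)) : ℕ) = a := rfl
          rw [e] at this
          simp only [F, Fin.cons_succ, Pi.smul_apply, smul_eq_mul, Fin.val_succ, pow_succ,
            Function.comp]
          nlinarith) (Fin.succ 0)
    rw [Matrix.smul_vecMul, ← hwx] at h0
    have h1 := hpos (ι 0)
    have e : ι 0 = 0 := rfl
    simp only [F, Fin.cons_succ, Pi.smul_apply, smul_eq_mul, Function.comp, e] at h0
    simp only [e, Fin.val_zero, pow_zero, mul_one] at h1
    linarith
lemma det_indicator_nonneg {m : ℕ} {g h : Fin m → ℕ} (hg : StrictMono g) (hh : Monotone h) :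
    0 ≤ (Matrix.of fun a b : Fin m => if g b = h a then (1 : ℝ) else 0).det := by
  by_cases hinj : Function.Injective h
  · have hs : StrictMono h := hh.strictMono_of_injective hinj
    by_cases hr : ∀ a, ∃ b, g b = h a
    · choose φ hφ using hr
      have hφs : StrictMono φ := fun a b hab => by
        have := hs hab
        rw [← hφ, ← hφ] at this
        exact hg.lt_iff_lt.mp this
      have hφi : φ = id := by
        refine (StrictMono.range_inj hφs strictMono_id).mp ?_
        rw [Set.range_id, (Finite.injective_iff_surjective.mp hφs.injective).range_eq]
      have h1 : (Matrix.of fun a b : Fin m => if g b = h a then (1 : ℝ) else 0) = 1 := by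
        ext a b
        have := hφ a
        rw [hφi, id] at this
        rw [Matrix.of_apply, ← this, Matrix.one_apply]
        simp only [hg.injective.eq_iff, eq_comm]
      rw [h1, Matrix.det_one]
      norm_num
    · push Not at hr
      obtain ⟨a, ha⟩ := hr
      rw [Matrix.det_eq_zero_of_row_eq_zero a fun b => by simp [ha b]]
  · simp only [Function.Injective, not_forall] at hinj
    obtain ⟨a, a', haa, hne⟩ := hinj
    rw [Matrix.det_zero_of_row_eq hne (by ext b; simp [haa])]

/-- A matrix with nonnegative rows supported on consecutive pairs of columns moving to the right
has nonnegative determinant. -/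
lemma det_staircase_nonneg {m : ℕ} {g i : Fin m → ℕ} (hg : StrictMono g) (hi : StrictMono i)
    {q r : Fin m → ℝ} (hq : ∀ a, 0 ≤ q a) (hr : ∀ a, 0 ≤ r a) :
    0 ≤ (Matrix.of fun a b : Fin m => q a * (if g b = i a then (1 : ℝ) else 0) +
      r a * (if g b = i a + 1 then (1 : ℝ) else 0)).det := by
  let P : ℕ → Fin m → ℝ := fun x b => if g b = x then 1 else 0
  let c : Fin m → Fin 2 → ℝ := fun a => ![q a, r a]
  have h1 := (Matrix.detRowAlternating (R := ℝ) (n := Fin m)).toMultilinearMap.map_sum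
    (fun a (e : Fin 2) => c a e • P (i a + e))
  have h2 : (Matrix.of fun a b : Fin m => q a * (if g b = i a then (1 : ℝ) else 0) +
      r a * (if g b = i a + 1 then (1 : ℝ) else 0)).det =
      (Matrix.detRowAlternating (R := ℝ) (n := Fin m)).toMultilinearMap
        (fun a => ∑ e : Fin 2, c a e • P (i a + e)) := by
    refine congrArg Matrix.det ?_
    ext a b
    simp [Fin.sum_univ_two, c, P]
  rw [h2, h1]
  refine Finset.sum_nonneg fun s _ => ?_
  rw [MultilinearMap.map_smul_univ, smul_eq_mul]
  refine mul_nonneg (Finset.prod_nonneg fun a _ => ?_) ?_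
  · obtain h | h : s a = 0 ∨ s a = 1 := by omega
    · simp [h, c, hq]
    · simp [h, c, hr]
  · exact det_indicator_nonneg (h := fun a => i a + s a) hg (monotone_iff_forall_lt.mpr
      fun a b hab => by
        have := hi hab
        have := (s a).2
        omega)

/-- The staircase matrix with an additional column of alternating signs on the left. -/
lemma det_staircase_cons_nonneg {m : ℕ} {g i : Fin m → ℕ} (hg : StrictMono g) (hi : StrictMono i)
    (hi0 : ∀ a, 0 < i a) {p q r : Fin m → ℝ} (hp : ∀ a, 0 ≤ p a) (hq : ∀ a, 0 ≤ q a)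
    (hr : ∀ a, 0 ≤ r a) :
    0 ≤ (Matrix.of fun a b : Fin m => (-1) ^ (a : ℕ) * p a * (if g b = 0 then (1 : ℝ) else 0) +
      (q a * (if g b = i a then (1 : ℝ) else 0) +
        r a * (if g b = i a + 1 then (1 : ℝ) else 0))).det := by
  rcases m with _ | m
  · simp
  have hgs : ∀ b : Fin m, g b.succ ≠ 0 := fun b => by
    have := hg (Fin.succ_pos b)
    omega
  by_cases hg0 : g 0 = 0
  · rw [Matrix.det_succ_column_zero]
    refine Finset.sum_nonneg fun a _ => ?_
    have hne : (0 : ℕ) ≠ i a := (hi0 a).ne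
    simp only [Matrix.of_apply, hg0, if_true, hne, if_false]
    have h1 : (-1 : ℝ) ^ (a : ℕ) * (-1) ^ (a : ℕ) = 1 := neg_one_pow_mul_of_even ⟨a, rfl⟩
    have h2 := det_staircase_nonneg (g := g ∘ Fin.succ) (i := i ∘ a.succAbove)
      (hg.comp Fin.strictMono_succ) (hi.comp (Fin.strictMono_succAbove a))
      (q := q ∘ a.succAbove) (r := r ∘ a.succAbove) (fun _ => hq _) (fun _ => hr _)
    refine le_of_le_of_eq (mul_nonneg (hp a) h2) ?_
    have h3 : (Matrix.of fun a b : Fin (m + 1) =>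
        (-1) ^ (a : ℕ) * p a * (if g b = 0 then (1 : ℝ) else 0) +
        (q a * (if g b = i a then (1 : ℝ) else 0) +
        r a * (if g b = i a + 1 then (1 : ℝ) else 0))).submatrix a.succAbove Fin.succ =
        Matrix.of fun a_1 b : Fin m =>
        (q ∘ a.succAbove) a_1 * (if (g ∘ Fin.succ) b = (i ∘ a.succAbove) a_1 then (1 : ℝ) else 0) +
        (r ∘ a.succAbove) a_1 *
          (if (g ∘ Fin.succ) b = (i ∘ a.succAbove) a_1 + 1 then (1 : ℝ) else 0) := by
      ext a' b
      simp [hgs b]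
    rw [h3]
    simp only [Nat.zero_ne_add_one, if_false]
    linear_combination (-(p a) * (Matrix.of fun a_1 b : Fin m =>
        (q ∘ a.succAbove) a_1 * (if (g ∘ Fin.succ) b = (i ∘ a.succAbove) a_1 then (1 : ℝ) else 0) +
        (r ∘ a.succAbove) a_1 *
          (if (g ∘ Fin.succ) b = (i ∘ a.succAbove) a_1 + 1 then (1 : ℝ) else 0)).det) * h1
  · refine le_of_le_of_eq (det_staircase_nonneg hg hi hq hr) (congrArg Matrix.det ?_)
    ext a b
    have hb : g b ≠ 0 := by
      have := hg.monotone (Fin.zero_le b)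
      omega
    simp [hb]

lemma exists_last_of_lt {P : ℕ → Prop} {a b : ℕ} (hab : a < b) (ha : P a) (hb : ¬ P b) :
    ∃ i, a ≤ i ∧ i < b ∧ P i ∧ ¬ P (i + 1) := by
  by_contra hcon
  push Not at hcon
  have : ∀ i, a ≤ i → i ≤ b → P i := by
    intro i hi
    induction i, hi using Nat.le_induction with
    | base => exact fun _ => ha
    | succ j hj ih => exact fun h => hcon j hj (by omega) (ih (by omega))
  exact hb (this b hab.le le_rfl)

/-- If `v` starts positive and has exactly `k ≥ 1` sign changes, then there are `k` positions at
which `v` passes from strictly positive to nonpositive, or the reverse, in alternation. -/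
lemma exists_sign_change_positions {k n : ℕ} (hk : 1 ≤ k) (hn : 0 < n) {v : Fin n → ℝ}
    (h0 : 0 < v ⟨0, hn⟩) (hv : signChanges v = k) :
    ∃ i : Fin k → ℕ, StrictMono i ∧ ∃ hi : ∀ a, i a + 1 < n,
      (∀ a : Fin k, 0 < (-1) ^ (a : ℕ) * v ⟨i a, (Nat.lt_succ_self _).trans (hi a)⟩) ∧
      (∀ a : Fin k, (-1) ^ (a : ℕ) * v ⟨i a + 1, hi a⟩ ≤ 0) := by
  have hbdd : BddAbove {m | ∃ f : Fin (m + 1) → Fin n, StrictMono f ∧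
      ∀ j : Fin m, v (f j.castSucc) * v (f j.succ) < 0} := by
    refine ⟨n, ?_⟩
    rintro m ⟨f, hf, -⟩
    have := Fintype.card_le_of_injective f hf.injective
    simp only [Fintype.card_fin] at this
    omega
  have hne : {m | ∃ f : Fin (m + 1) → Fin n, StrictMono f ∧
      ∀ j : Fin m, v (f j.castSucc) * v (f j.succ) < 0}.Nonempty := by
    by_contra hcon
    rw [Set.not_nonempty_iff_eq_empty] at hcon
    rw [signChanges, hcon] at hv
    simp at hv
    omega
  have hmem := Nat.sSup_mem hne hbdd
  have hub : ∀ m, (∃ f : Fin (m + 1) → Fin n, StrictMono f ∧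
      ∀ j : Fin m, v (f j.castSucc) * v (f j.succ) < 0) → m ≤ k := fun m hm => by
    rw [← hv]; exact le_csSup hbdd hm
  rw [show sSup {m | ∃ f : Fin (m + 1) → Fin n, StrictMono f ∧
    ∀ j : Fin m, v (f j.castSucc) * v (f j.succ) < 0} = k from hv] at hmem
  obtain ⟨f, hf, hneg⟩ := hmem
  have hpos := pos_of_consecutive_mul_neg (fun a => v (f a)) hneg (by omega)
  have hf0 : 0 < v (f 0) := by
    by_contra hcon
    have h1 : v (f 0) < 0 := by
      refine lt_of_le_of_ne (not_lt.mp hcon) fun h => ?_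
      have := hpos 0
      simp [h] at this
    have h2 : (⟨0, hn⟩ : Fin n) < f 0 := by
      refine lt_of_le_of_ne (Fin.mk_le_of_le_val (Nat.zero_le _)) fun h => ?_
      rw [h] at h0
      linarith
    have := hub (k + 1) ⟨Fin.cons ⟨0, hn⟩ f, ?_, ?_⟩
    · omega
    · refine Fin.strictMono_iff_lt_succ.mpr fun a => ?_
      refine Fin.cases ?_ (fun a => ?_) a
      · simpa using h2
      · rw [← Fin.succ_castSucc]
        simp only [Fin.cons_succ]
        exact hf Fin.castSucc_lt_succ
    · intro j
      refine Fin.cases ?_ (fun a => ?_) j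
      · simpa using mul_neg_of_pos_of_neg h0 h1
      · rw [← Fin.succ_castSucc]
        simp only [Fin.cons_succ]
        exact hneg a
  have hpos' : ∀ a : Fin (k + 1), 0 < (-1) ^ (a : ℕ) * v (f a) := fun a => by
    have := hpos a
    rw [mul_assoc] at this
    exact pos_of_mul_pos_right this hf0.le
  have hex : ∀ a : Fin k, ∃ i : ℕ, (f a.castSucc : ℕ) ≤ i ∧ i < (f a.succ : ℕ) ∧
      (∃ h : i < n, 0 < (-1) ^ (a : ℕ) * v ⟨i, h⟩) ∧
      ¬ (∃ h : i + 1 < n, 0 < (-1) ^ (a : ℕ) * v ⟨i + 1, h⟩) := by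
    intro a
    refine exists_last_of_lt (P := fun i => ∃ h : i < n, 0 < (-1) ^ (a : ℕ) * v ⟨i, h⟩)
      (hf Fin.castSucc_lt_succ) ⟨(f a.castSucc).2, hpos' a.castSucc⟩ ?_
    rintro ⟨_, h⟩
    have h2 := hpos' a.succ
    rw [Fin.val_succ, pow_succ] at h2
    simp only [Fin.eta] at h
    linarith
  choose i hi1 hi2 hi3 hi4 using hex
  have hin : ∀ a, i a + 1 < n := fun a => by
    have := hi2 a
    have := (f a.succ).2
    omega
  refine ⟨i, fun a b hab => ?_, hin, fun a => (hi3 a).2, fun a => ?_⟩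
  · have h1 := hi2 a
    have h2 := hi1 b
    have h3 := hf.monotone (show a.succ ≤ b.castSucc from hab)
    rw [Fin.le_def] at h3
    omega
  · by_contra hcon
    exact hi4 a ⟨hin a, not_le.mp hcon⟩

/-- Every `Y` satisfying the sign conditions is the image of a totally nonnegative matrix. -/
lemma exists_nonneg_of_signChanges {k n : ℕ} (hk : 1 ≤ k) (hkn : k + 2 ≤ n)
    {Z : Matrix (Fin n) (Fin (k + 2)) ℝ}
    (hZ : ∀ f : Fin (k + 2) → Fin n, StrictMono f → 0 < (Z.submatrix f id).det)
    {Y : Matrix (Fin k) (Fin (k + 2)) ℝ} (hY : LinearIndependent ℝ (fun i => Y i))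
    (hpos : ∀ i : Fin (n - 1), 0 < twist Y ![Z ⟨i.val, val_lt_of_pred i⟩,
      Z ⟨i.val + 1, val_succ_lt_of_pred i⟩])
    (hvar : signChanges (fun j : Fin (n - 1) =>
      twist Y ![Z ⟨0, by omega⟩, Z ⟨j.val + 1, val_succ_lt_of_pred j⟩]) = k) :
    ∃ C : Matrix (Fin k) (Fin n) ℝ, LinearIndependent ℝ (fun i => C i) ∧
      (∀ f : Fin k → Fin n, StrictMono f → 0 ≤ (C.submatrix id f).det) ∧
      Submodule.span ℝ (Set.range fun i => Y i) =
        Submodule.span ℝ (Set.range fun i => (C * Z) i) := by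
  have h01 := hpos ⟨0, by omega⟩
  obtain ⟨i, hi, hin, hi1, hi2⟩ := exists_sign_change_positions hk (by omega) h01 hvar
  simp only [] at hi1 hi2
  -- column indices are shifted by one
  let p : Fin k → ℝ := fun a => twist Y ![Z ⟨i a + 1, by have := hin a; omega⟩,
    Z ⟨i a + 1 + 1, by have := hin a; omega⟩]
  let q : Fin k → ℝ := fun a => -((-1) ^ (a : ℕ) * twist Y ![Z ⟨0, by omega⟩,
    Z ⟨i a + 1 + 1, by have := hin a; omega⟩])
  let r : Fin k → ℝ := fun a => (-1) ^ (a : ℕ) * twist Y ![Z ⟨0, by omega⟩,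
    Z ⟨i a + 1, by have := hin a; omega⟩]
  have hp : ∀ a, 0 ≤ p a := fun a => (hpos ⟨i a + 1, hin a⟩).le
  have hq : ∀ a, 0 ≤ q a := fun a => neg_nonneg.mpr (hi2 a)
  have hr : ∀ a, 0 < r a := fun a => hi1 a
  let C : Matrix (Fin k) (Fin n) ℝ := Matrix.of fun a j =>
    (-1) ^ (a : ℕ) * p a * (if (j : ℕ) = 0 then (1 : ℝ) else 0) +
      (q a * (if (j : ℕ) = i a + 1 then (1 : ℝ) else 0) +
        r a * (if (j : ℕ) = i a + 1 + 1 then (1 : ℝ) else 0))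
  have hC0 : ∀ f : Fin k → Fin n, StrictMono f → 0 ≤ (C.submatrix id f).det := fun f hf =>
    det_staircase_cons_nonneg (g := fun b => (f b : ℕ)) (i := fun a => i a + 1) hf
      (fun a b h => Nat.succ_lt_succ (hi h)) (fun a => Nat.succ_pos _) hp hq (fun a => (hr a).le)
  have hClin : LinearIndependent ℝ (fun i => C i) := by
    let g : Fin k → Fin n := fun b => ⟨i b + 1 + 1, by have := hin b; omega⟩
    have hdet : (C.submatrix id g).det ≠ 0 := by
      rw [Matrix.det_of_isLowerTriangular]
      · refine Finset.prod_ne_zero_iff.mpr fun a _ => ?_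
        simp [C, g, (hr a).ne']
      · intro a b hab
        have h1 : i a < i b := hi hab
        simp only [Matrix.submatrix_apply, C, g, id, Matrix.of_apply]
        rw [if_neg (by omega), if_neg (by omega), if_neg (by omega)]
        ring
    have h1 := Matrix.linearIndependent_rows_of_det_ne_zero hdet
    refine LinearIndependent.of_comp (LinearMap.funLeft ℝ ℝ g) ?_
    exact h1
  refine ⟨C, hClin, hC0, ?_⟩
  have hCZ := linearIndependent_mul (by omega) hkn hZ hClin hC0
  refine (Submodule.eq_of_le_of_finrank_eq ?_ ?_).symm
  · rw [Submodule.span_le]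
    rintro _ ⟨a, rfl⟩
    have h1 := Submodule.smul_mem _ ((-1 : ℝ) ^ (a : ℕ)) (twist_combination_mem_span h01.ne'
      (Z ⟨i a + 1, by have := hin a; omega⟩) (Z ⟨i a + 1 + 1, by have := hin a; omega⟩))
    have h2 : (C * Z) a = (-1 : ℝ) ^ (a : ℕ) • (p a • Z ⟨0, by omega⟩ -
        twist Y ![Z ⟨0, by omega⟩, Z ⟨i a + 1 + 1, by have := hin a; omega⟩] •
          Z ⟨i a + 1, by have := hin a; omega⟩ +
        twist Y ![Z ⟨0, by omega⟩, Z ⟨i a + 1, by have := hin a; omega⟩] •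
          Z ⟨i a + 1 + 1, by have := hin a; omega⟩) := by
      ext t
      have hsum : ∀ (x : ℕ) (hx : x < n) (c : ℝ),
          ∑ j : Fin n, c * (if (j : ℕ) = x then (1 : ℝ) else 0) * Z j t = c * Z ⟨x, hx⟩ t := by
        intro x hx c
        rw [Finset.sum_eq_single ⟨x, hx⟩]
        · simp
        · intro b _ hb
          rw [if_neg fun h => hb (Fin.ext h)]
          ring
        · simp
      rw [Matrix.mul_apply]
      simp only [C, Matrix.of_apply, add_mul, Finset.sum_add_distrib]
      rw [hsum 0 (by omega), hsum (i a + 1) (by have := hin a; omega),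
        hsum (i a + 1 + 1) (by have := hin a; omega)]
      simp only [Pi.smul_apply, Pi.add_apply, Pi.sub_apply, smul_eq_mul, q, r]
      ring
    simp only [h2, SetLike.mem_coe]
    exact h1
  · rw [finrank_span_eq_card hCZ, finrank_span_eq_card hY]

lemma strictMono_orderIsoOfFin {k n : ℕ} {S : Finset (Fin n)} (h : S.card = k) :
    StrictMono fun t => ((S.orderIsoOfFin h) t).val :=
  fun _ _ hab => (S.orderIsoOfFin h).strictMono hab

/-- A property of the increasing enumerations of all `k`-subsets is a property of all strictly
increasing maps. -/
lemma forall_orderIsoOfFin_iff {k n : ℕ} {P : (Fin k → Fin n) → Prop} :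
    (∀ (S : Finset (Fin n)) (h : S.card = k), P fun t => ((S.orderIsoOfFin h) t).val) ↔
      ∀ f : Fin k → Fin n, StrictMono f → P f := by
  refine ⟨fun hP f hf => ?_, fun hP S h => hP _ (strictMono_orderIsoOfFin h)⟩
  have hcard : (Finset.univ.image f).card = k := by
    rw [Finset.card_image_of_injective _ hf.injective, Finset.card_univ, Fintype.card_fin]
  have h1 := Finset.orderEmbOfFin_unique hcard
    (fun x => Finset.mem_image_of_mem f (Finset.mem_univ x)) hf
  have h2 := hP _ hcard
  rwa [show (fun t => ((Finset.univ.image f).orderIsoOfFin hcard t).val) = f from h1.symm] at h2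

lemma posDef_mul_transpose {k n : ℕ} {C : Matrix (Fin k) (Fin n) ℝ}
    (hC : LinearIndependent ℝ (fun i => C i)) : (C * C.transpose).PosDef := by
  rw [← Matrix.conjTranspose_eq_transpose_of_trivial]
  exact Matrix.PosDef.mul_conjTranspose_self C (Matrix.vecMul_injective_iff.mpr hC)

open scoped MatrixOrder in
/-- The rows of a full-rank matrix can be orthonormalized preserving orientation. -/
lemma exists_mul_transpose_eq_one {k n : ℕ} {C : Matrix (Fin k) (Fin n) ℝ}
    (hC : LinearIndependent ℝ (fun i => C i)) :
    ∃ M : Matrix (Fin k) (Fin k) ℝ, 0 < M.det ∧ (M * C) * (M * C).transpose = 1 := by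
  have hS := posDef_mul_transpose hC
  set S := C * C.transpose with hSdef
  have hy := Matrix.nonneg_iff_posSemidef.mp (CFC.sqrt_nonneg S)
  have hyy : CFC.sqrt S * CFC.sqrt S = S := CFC.sqrt_mul_sqrt_self S hS.posSemidef.nonneg
  set y := CFC.sqrt S
  have hydet : 0 < y.det := by
    refine lt_of_le_of_ne hy.det_nonneg fun h => ?_
    have h1 := hS.det_pos
    rw [← hyy, Matrix.det_mul, ← h] at h1
    simp at h1
  have hu : IsUnit y.det := hydet.ne'.isUnit
  have hyt : y.transpose = y := by
    rw [← Matrix.conjTranspose_eq_transpose_of_trivial]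
    exact hy.isHermitian
  refine ⟨y⁻¹, ?_, ?_⟩
  · rw [Matrix.det_nonsing_inv, Ring.inverse_eq_inv']
    exact inv_pos.mpr hydet
  · rw [Matrix.transpose_mul, Matrix.transpose_nonsing_inv, hyt, Matrix.mul_assoc,
      ← Matrix.mul_assoc C, ← hSdef, ← hyy, Matrix.mul_assoc, Matrix.mul_nonsing_inv _ hu,
      Matrix.mul_one, Matrix.nonsing_inv_mul _ hu]

lemma span_rows_mul_le {k m n : ℕ} (M : Matrix (Fin m) (Fin k) ℝ) (G : Matrix (Fin k) (Fin n) ℝ) :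
    Submodule.span ℝ (Set.range fun i => (M * G) i) ≤
      Submodule.span ℝ (Set.range fun i => G i) := by
  rw [Submodule.span_le]
  rintro _ ⟨i, rfl⟩
  refine (Submodule.mem_span_range_iff_exists_fun ℝ).mpr ⟨M i, ?_⟩
  ext t
  simp [Matrix.mul_apply]

/-- Two full-rank matrices have the same row span iff the first is fixed by the orthogonal
projection onto the row span of the second. -/
lemma span_rows_eq_iff {k n : ℕ} {E G : Matrix (Fin k) (Fin n) ℝ}
    (hE : LinearIndependent ℝ (fun i => E i)) (hG : LinearIndependent ℝ (fun i => G i)) :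
    Submodule.span ℝ (Set.range fun i => E i) = Submodule.span ℝ (Set.range fun i => G i) ↔
      (G * G.transpose).det • E = E * G.transpose * (G * G.transpose).adjugate * G := by
  constructor
  · intro h
    have h1 : ∀ i, ∃ c : Fin k → ℝ, ∑ j, c j • G j = E i := fun i => by
      refine (Submodule.mem_span_range_iff_exists_fun ℝ).mp ?_
      rw [← h]
      exact Submodule.subset_span ⟨i, rfl⟩
    choose M hM using h1
    have h2 : E = Matrix.of M * G := by
      ext i t
      rw [← hM i]
      simp [Matrix.mul_apply]
    rw [h2, Matrix.mul_assoc (Matrix.of M), Matrix.mul_assoc (Matrix.of M), Matrix.mul_adjugate,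
      Matrix.mul_smul, Matrix.mul_one, Matrix.smul_mul]
  · intro h
    have h2 : E = ((G * G.transpose).det⁻¹ •
        (E * G.transpose * (G * G.transpose).adjugate)) * G := by
      rw [Matrix.smul_mul, ← h, smul_smul, inv_mul_cancel₀ (posDef_mul_transpose hG).det_pos.ne',
        one_smul]
    refine Submodule.eq_of_le_of_finrank_eq ?_ ?_
    · rw [h2]
      exact span_rows_mul_le _ _
    · rw [finrank_span_eq_card hE, finrank_span_eq_card hG]

lemma span_rows_mul_eq {k n : ℕ} {M : Matrix (Fin k) (Fin k) ℝ} (hM : M.det ≠ 0)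
    (G : Matrix (Fin k) (Fin n) ℝ) :
    Submodule.span ℝ (Set.range fun i => (M * G) i) =
      Submodule.span ℝ (Set.range fun i => G i) := by
  refine le_antisymm (span_rows_mul_le M G) ?_
  have h := span_rows_mul_le M⁻¹ (M * G)
  rwa [← Matrix.mul_assoc, Matrix.nonsing_inv_mul _ hM.isUnit, Matrix.one_mul] at h

lemma linearIndependent_of_mul_transpose_eq_one {k n : ℕ} {Q : Matrix (Fin k) (Fin n) ℝ}
    (hQ : Q * Q.transpose = 1) : LinearIndependent ℝ (fun i => Q i) := by
  refine Matrix.vecMul_injective_iff.mp fun u v h => ?_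
  have h1 := congrArg (fun w => Matrix.vecMul w Q.transpose) h
  simpa [Matrix.vecMul_vecMul, hQ] using h1

/-- The matrices with orthonormal rows and nonnegative maximal minors form a compact set. -/
lemma isCompact_orthonormal_nonneg (k n : ℕ) :
    IsCompact {Q : Matrix (Fin k) (Fin n) ℝ | Q * Q.transpose = 1 ∧
      ∀ f : Fin k → Fin n, StrictMono f → 0 ≤ (Q.submatrix id f).det} := by
  have hbox : IsCompact (Set.pi Set.univ fun _ : Fin k =>
      Set.pi Set.univ fun _ : Fin n => Set.Icc (-1 : ℝ) 1) :=
    isCompact_univ_pi fun _ => isCompact_univ_pi fun _ => isCompact_Icc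
  refine hbox.of_isClosed_subset ?_ ?_
  · have h1 : IsClosed {Q : Matrix (Fin k) (Fin n) ℝ | Q * Q.transpose = 1} :=
      isClosed_eq (by fun_prop) continuous_const
    have h2 : IsClosed (⋂ (f : Fin k → Fin n) (_ : StrictMono f),
        {Q : Matrix (Fin k) (Fin n) ℝ | 0 ≤ (Q.submatrix id f).det}) :=
      isClosed_iInter fun f => isClosed_iInter fun _ =>
      isClosed_le continuous_const (Continuous.matrix_det (continuous_id.matrix_submatrix _ _))
    refine (congrArg IsClosed ?_).mp (h1.inter h2)
    ext Q
    simp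
  · rintro Q ⟨hQ, -⟩ i - j -
    have h1 : ∑ j, Q i j * Q i j = 1 :=
      (congrFun (congrFun hQ i) i).trans (Matrix.one_apply_eq i)
    have h2 : Q i j * Q i j ≤ 1 := by
      rw [← h1]
      exact Finset.single_le_sum (f := fun j => Q i j * Q i j)
        (fun j _ => mul_self_nonneg (Q i j)) (Finset.mem_univ j)
    exact abs_le.mp (abs_le_one_iff_mul_self_le_one.mpr h2)

/-- The amplituhedron is closed. -/
lemma isClosed_setOf_image {k n p : ℕ} (hkp : k ≤ p) (hpn : p ≤ n)
    {Z : Matrix (Fin n) (Fin p) ℝ}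
    (hZ : ∀ f : Fin p → Fin n, StrictMono f → 0 < (Z.submatrix f id).det) :
    IsClosed {P : Gr k p | ∃ C : Matrix (Fin k) (Fin n) ℝ, LinearIndependent ℝ (fun i => C i) ∧
      (∀ f : Fin k → Fin n, StrictMono f → 0 ≤ (C.submatrix id f).det) ∧
      ∃ (E : Matrix (Fin k) (Fin p) ℝ) (hE : LinearIndependent ℝ (fun i => E i)),
        grMk E hE = P ∧ Submodule.span ℝ (Set.range fun i => E i) =
          Submodule.span ℝ (Set.range fun i => (C * Z) i)} := by
  let K := {Q : Matrix (Fin k) (Fin n) ℝ | Q * Q.transpose = 1 ∧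
      ∀ f : Fin k → Fin n, StrictMono f → 0 ≤ (Q.submatrix id f).det}
  have : CompactSpace K := isCompact_iff_compactSpace.mp (isCompact_orthonormal_nonneg k n)
  have hval : Continuous fun E : FullRk k p => E.1 := continuous_subtype_val
  let R : Set (K × FullRk k p) := {x | (x.1.1 * Z * (x.1.1 * Z).transpose).det • x.2.1 =
    x.2.1 * (x.1.1 * Z).transpose * (x.1.1 * Z * (x.1.1 * Z).transpose).adjugate * (x.1.1 * Z)}
  have hR : IsClosed R := by
    have h1 : Continuous fun x : K × FullRk k p => x.1.1 * Z :=
      (continuous_subtype_val.comp continuous_fst).matrix_mul continuous_const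
    have h2 : Continuous fun x : K × FullRk k p => x.2.1 := hval.comp continuous_snd
    have h3 := h1.matrix_mul h1.matrix_transpose
    exact isClosed_eq (h3.matrix_det.smul h2)
      (((h2.matrix_mul h1.matrix_transpose).matrix_mul h3.matrix_adjugate).matrix_mul h1)
  refine (isQuotientMap_quot_mk (r := (grSetoid k p).r)).isClosed_preimage.mp ?_
  convert isClosedMap_snd_of_compactSpace R hR using 1
  ext E
  have hQZ : ∀ Q : K, LinearIndependent ℝ (fun i => (Q.1 * Z) i) := fun Q =>
    linearIndependent_mul hkp hpn hZ (linearIndependent_of_mul_transpose_eq_one Q.2.1) Q.2.2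
  constructor
  · rintro ⟨C, hC, hC0, E', _, hEE, hspan⟩
    have h1 : Submodule.span ℝ (Set.range fun i => E' i) =
        Submodule.span ℝ (Set.range fun i => E.1 i) := Quotient.exact hEE
    obtain ⟨M, hM, hMC⟩ := exists_mul_transpose_eq_one hC
    let Q : K := ⟨M * C, hMC, fun f hf => by
      have h2 : (M * C).submatrix id f = M * C.submatrix id f := by
        ext i j
        simp [Matrix.mul_apply]
      rw [h2, Matrix.det_mul]
      exact mul_nonneg hM.le (hC0 f hf)⟩
    refine ⟨(Q, E), (span_rows_eq_iff E.2 (hQZ Q)).mp ?_, rfl⟩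
    rw [← h1, hspan, Matrix.mul_assoc, span_rows_mul_eq hM.ne']
  · rintro ⟨⟨Q, E'⟩, hmem, rfl⟩
    exact ⟨Q.1, linearIndependent_of_mul_transpose_eq_one Q.2.1, Q.2.2, E'.1, E'.2, rfl,
      (span_rows_eq_iff E'.2 (hQZ Q)).mpr hmem⟩

/-- The `m = 2` amplituhedron is the closure of the locus cut out by the sign
conditions on consecutive twistor coordinates together with the sign-flip
count `var = k`. -/
theorem stmt10 (k n : ℕ) (hk : 1 ≤ k) (hkn : k ≤ n - 2)
    (Z : Matrix (Fin n) (Fin (k + 2)) ℝ) (hZ : posMaxMinors Z)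
    (A : Set (Gr k (k + 2)))
    (hA : A = {P | ∃ (C : Matrix (Fin k) (Fin n) ℝ)
        (hC : LinearIndependent ℝ (fun i => C i)),
        (∀ (S : Finset (Fin n)) (h : S.card = k), 0 ≤ pluck C S h) ∧
        ∃ (E : Matrix (Fin k) (Fin (k + 2)) ℝ)
          (hE : LinearIndependent ℝ (fun i => E i)),
          grMk E hE = P ∧
          Submodule.span ℝ (Set.range (fun i => E i)) =
            Submodule.span ℝ (Set.range (fun i => (C * Z) i))}) :
    A = closure {P : Gr k (k + 2) |
      ∃ (Y : Matrix (Fin k) (Fin (k + 2)) ℝ)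
        (hY : LinearIndependent ℝ (fun i => Y i)),
        grMk Y hY = P ∧
        (∀ i : Fin (n - 1),
          0 < twist Y ![Z ⟨i.val, by have := i.isLt; omega⟩,
                        Z ⟨i.val + 1, by have := i.isLt; omega⟩]) ∧
        0 < twist Y ![Z ⟨n - 1, by omega⟩, ((-1 : ℝ) ^ (k + 1)) • Z ⟨0, by omega⟩] ∧
        signChanges (fun j : Fin (n - 1) =>
          twist Y ![Z ⟨0, by omega⟩, Z ⟨j.val + 1, by have := j.isLt; omega⟩]) = k} := by
  have hkn' : k + 2 ≤ n := by omega
  have hZ' : ∀ f : Fin (k + 2) → Fin n, StrictMono f → 0 < (Z.submatrix f id).det :=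
    forall_orderIsoOfFin_iff (P := fun f => 0 < (Z.submatrix f id).det).mp hZ
  have hA' : A = {P | ∃ C : Matrix (Fin k) (Fin n) ℝ, LinearIndependent ℝ (fun i => C i) ∧
      (∀ f : Fin k → Fin n, StrictMono f → 0 ≤ (C.submatrix id f).det) ∧
      ∃ (E : Matrix (Fin k) (Fin (k + 2)) ℝ) (hE : LinearIndependent ℝ (fun i => E i)),
        grMk E hE = P ∧ Submodule.span ℝ (Set.range fun i => E i) =
          Submodule.span ℝ (Set.range fun i => (C * Z) i)} := by
    rw [hA]
    ext P
    refine exists_congr fun C => exists_prop.trans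
      (and_congr_right fun _ => and_congr_left fun _ => ?_)
    exact forall_orderIsoOfFin_iff (P := fun f => 0 ≤ (C.submatrix id f).det)
  refine Set.Subset.antisymm ?_ (closure_minimal ?_ ?_)
  · rw [hA']
    rintro P ⟨C, hC, hC0, E, hE, rfl, hspan⟩
    obtain ⟨D, hD, hDpos⟩ := exists_tendsto_pos hC hC0
    have hDlin : ∀ m, LinearIndependent ℝ (fun i => (D m * Z) i) := fun m => by
      have hm : k ≤ n := by omega
      refine linearIndependent_mul (by omega) hkn' hZ' ?_ fun f hf => (hDpos m f hf).le
      have h1 := Matrix.linearIndependent_rows_of_det_ne_zero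
        (hDpos m (Fin.castLE hm) (Fin.strictMono_castLE hm)).ne'
      exact LinearIndependent.of_comp (LinearMap.funLeft ℝ ℝ (Fin.castLE hm)) h1
    have hCZ := linearIndependent_mul (by omega) hkn' hZ' hC hC0
    have hEq : grMk E hE = grMk (C * Z) hCZ := Quotient.sound hspan
    have hlim : Filter.Tendsto (fun m => grMk (D m * Z) (hDlin m)) Filter.atTop
        (nhds (grMk (C * Z) hCZ)) := by
      have hcont : Continuous fun x : FullRk k (k + 2) => (Quotient.mk (grSetoid k (k + 2)) x :
        Gr k (k + 2)) := continuous_quotient_mk'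
      refine (hcont.tendsto _).comp (f := fun m => (⟨D m * Z, hDlin m⟩ : FullRk k (k + 2))) ?_
      refine tendsto_subtype_rng.mpr ?_
      exact ((continuous_id.matrix_mul continuous_const).tendsto C).comp hD
    rw [hEq]
    refine mem_closure_of_tendsto hlim (Filter.Eventually.of_forall fun m => ?_)
    refine ⟨D m * Z, hDlin m, rfl, fun i => ?_, ?_, signChanges_twist_mul hk hkn' hZ' (hDpos m)⟩
    · have := twist_mul_pos hkn' hZ' (hDpos m) (c := 1)
        (i := ⟨i.val, val_lt_of_pred i⟩) (j := ⟨i.val + 1, val_succ_lt_of_pred i⟩)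
        (Or.inl ⟨rfl, rfl⟩)
      rwa [one_smul] at this
    · exact twist_mul_pos hkn' hZ' (hDpos m) (Or.inr ⟨rfl, rfl, by omega, rfl⟩)
  · rw [hA']
    rintro P ⟨Y, hY, rfl, hpos, -, hvar⟩
    obtain ⟨C, hC, hC0, hspan⟩ := exists_nonneg_of_signChanges hk hkn' hZ' hY hpos hvar
    exact ⟨C, hC, hC0, Y, hY, rfl, hspan⟩
  · rw [hA']
    exact isClosed_setOf_image (by omega) hkn' hZ'
end
end

section
/- Let k, m ≥ 1 with k + m ≤ n and Z ∈ Mat^{>0}_{n,k+m} with rows Z_1,…,Z_n; set Ẑ_1 := (−1)^{k+m−1} Z_1 and r := ⌊m/2⌋. Define F°_{n,k,m}(Z) to be the set of Y ∈ Gr_{k,k+m} such that (up to a global sign of the twistor vector): (i) if m is even, ⟨Y Z_I⟩ > 0 for every I ⊆ [n] that is a disjoint union of r pairs of consecutive integers, and ⟨Y Z_I Z_n Ẑ_1⟩ > 0 for every I ⊆ {2,…,n−1} that is a disjoint union of r−1 pairs of consecutive integers; if m is odd, (−1)^k ⟨Y Z_I⟩ > 0 for every I = {1} ∪ (a disjoint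 union of r pairs of consecutive integers in {2,…,n}), and ⟨Y Z_I⟩ > 0 for every I = (a disjoint union of r pairs of consecutive integers in {1,…,n−1}) ∪ {n}; and (ii) var(⟨Y Z_1 ⋯ Z_{m−1} Z_m⟩, ⟨Y Z_1 ⋯ Z_{m−1} Z_{m+1}⟩, …, ⟨Y Z_1 ⋯ Z_{m−1} Z_n⟩) = k. Then A_{n,k,m}(Z) is contained in the closure of F°_{n,k,m}(Z) in Gr_{k,k+m}. -/
noncomputable section

lemma AlternatingMap.sum_apply_apply {E ι α : Type*} [AddCommGroup E] [Module ℝ E] (s : Finset α)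
    (F : α → E [⋀^ι]→ₗ[ℝ] ℝ) (x : ι → E) : (∑ a ∈ s, F a) x = ∑ a ∈ s, F a x := by
  classical
  induction s using Finset.induction_on with
  | empty => simp
  | insert a s ha ih => rw [Finset.sum_insert ha, Finset.sum_insert ha, AlternatingMap.add_apply, ih]

/-- The Cauchy–Binet expansion of an alternating form evaluated on the rows of `C` applied to a
family of vectors `z`. -/
lemma alternating_sum_smul_eq {E : Type*} [AddCommGroup E] [Module ℝ E] {k n : ℕ}
    (ω : E [⋀^Fin k]→ₗ[ℝ] ℝ) (C : Matrix (Fin k) (Fin n) ℝ) (z : Fin n → E) :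
    ω (fun i => ∑ j, C i j • z j) =
      ∑ a : Fin k ↪o Fin n, (C.submatrix id a).det * ω (z ∘ a) := by
  classical
  have key : ω.compLinearMap (Fintype.linearCombination ℝ z) =
      ∑ a : Fin k ↪o Fin n, ω (z ∘ a) •
        ((Matrix.detRowAlternating (n := Fin k) (R := ℝ)).compLinearMap
          (LinearMap.funLeft ℝ ℝ a)) := by
    refine Module.Basis.ext_alternating (Pi.basisFun ℝ (Fin n)) fun v hv => ?_
    set F := ω.compLinearMap (Fintype.linearCombination ℝ z)
    set G := ∑ a : Fin k ↪o Fin n, ω (z ∘ a) •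
        ((Matrix.detRowAlternating (n := Fin k) (R := ℝ)).compLinearMap
          (LinearMap.funLeft ℝ ℝ a)) with hG
    have hmono : StrictMono (v ∘ Tuple.sort v) :=
      (Tuple.monotone_sort v).strictMono_of_injective (hv.comp (Tuple.sort v).injective)
    set b : Fin k ↪o Fin n := OrderEmbedding.ofStrictMono _ hmono with hb
    have hv' : (fun i => Pi.basisFun ℝ (Fin n) (v i)) =
        (fun i => Pi.basisFun ℝ (Fin n) (b i)) ∘ (Tuple.sort v).symm := by
      ext i : 1
      simp [hb]
    rw [hv', AlternatingMap.map_perm, AlternatingMap.map_perm]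
    congr 1
    have h1 : F (fun i => Pi.basisFun ℝ (Fin n) (b i)) = ω (z ∘ b) := by
      simp only [F, AlternatingMap.compLinearMap_apply]
      congr 1
      ext i : 1
      simp [Fintype.linearCombination_apply, Pi.single_apply]
    rw [h1, hG, AlternatingMap.sum_apply_apply, Finset.sum_eq_single b]
    · rw [AlternatingMap.smul_apply, AlternatingMap.compLinearMap_apply]
      have : (fun i => LinearMap.funLeft ℝ ℝ b (Pi.basisFun ℝ (Fin n) (b i))) =
          (1 : Matrix (Fin k) (Fin k) ℝ) := by
        ext i j
        simp [LinearMap.funLeft_apply, Pi.single_apply, Matrix.one_apply, eq_comm]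
      rw [this]
      change _ = _ • Matrix.det (1 : Matrix (Fin k) (Fin k) ℝ)
      simp
    · intro a _ hab
      rw [AlternatingMap.smul_apply, AlternatingMap.compLinearMap_apply]
      have : ∃ i, ∀ j, a j ≠ b i := by
        by_contra! h
        apply hab
        have hs : (Finset.univ.image a).card = k := by
          rw [Finset.card_image_of_injective _ a.injective]; simp
        have e1 := Finset.orderEmbOfFin_unique hs (f := a) (by simp) a.strictMono
        have e2 := Finset.orderEmbOfFin_unique hs (f := b)
          (fun i => by obtain ⟨j, hj⟩ := h i; simp [← hj]) b.strictMono
        exact DFunLike.coe_injective (e1.trans e2.symm)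
      obtain ⟨i, hi⟩ := this
      rw [Matrix.detRowAlternating.map_coord_zero i, smul_zero]
      ext j
      simp [LinearMap.funLeft_apply, hi j]
    · simp
  have := congrArg (fun F => F fun i j => C i j) key
  simp only [AlternatingMap.compLinearMap_apply, AlternatingMap.sum_apply_apply,
    AlternatingMap.smul_apply, Fintype.linearCombination_apply] at this
  rw [this]
  refine Finset.sum_congr rfl fun a _ => ?_
  rw [smul_eq_mul, mul_comm]
  rfl

/-- Pivoting on the top left entry of a matrix. -/
lemma det_eq_pivot_mul_det {p : ℕ} (M : Matrix (Fin (p + 1)) (Fin (p + 1)) ℝ) (h : M 0 0 ≠ 0) :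
    M.det = M 0 0 * Matrix.det (Matrix.of fun i j : Fin p =>
      M i.succ j.succ - M i.succ 0 / M 0 0 * M 0 j.succ) := by
  have h1 := Matrix.det_eq_of_forall_row_eq_smul_add_const (A := M)
    (B := Matrix.of fun i j => M i j - (if i = 0 then 0 else M i 0 / M 0 0) * M 0 j)
    (fun i => if i = 0 then 0 else M i 0 / M 0 0) 0 (by simp) (by intro i j; simp)
  rw [h1, Matrix.det_succ_column_zero, Fin.sum_univ_succ, Finset.sum_eq_zero]
  · simp only [Fin.val_zero, pow_zero, one_mul, Matrix.of_apply, if_true, zero_mul, sub_zero,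
      add_zero]
    congr 2
  · intro i _
    simp [h]

/-- Cauchy matrices with increasing positive parameters have positive determinant. -/
lemma det_cauchy_pos : ∀ {p : ℕ} {x y : Fin p → ℝ}, (∀ i, 0 < x i) → (∀ i, 0 < y i) →
    StrictMono x → StrictMono y → 0 < (Matrix.of fun i j => (x i + y j)⁻¹).det
  | 0, _, _, _, _, _, _ => by simp
  | p + 1, x, y, hx, hy, hxm, hym => by
    have ih := det_cauchy_pos (x := x ∘ Fin.succ) (y := y ∘ Fin.succ) (fun i => hx _)
      (fun i => hy _) (hxm.comp Fin.strictMono_succ) (hym.comp Fin.strictMono_succ)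
    have h0 : 0 < (x 0 + y 0)⁻¹ := inv_pos.2 (add_pos (hx 0) (hy 0))
    rw [det_eq_pivot_mul_det _ (by simpa using h0.ne')]
    refine mul_pos (by simpa using h0) ?_
    have : (Matrix.of fun i j : Fin p => (Matrix.of fun i j => (x i + y j)⁻¹) i.succ j.succ -
        (Matrix.of fun i j => (x i + y j)⁻¹) i.succ 0 / (Matrix.of fun i j => (x i + y j)⁻¹) 0 0 *
          (Matrix.of fun i j => (x i + y j)⁻¹) 0 j.succ) =
        Matrix.of fun i j : Fin p => ((x i.succ - x 0) / (x i.succ + y 0)) *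
          (Matrix.of fun i j : Fin p => ((y j.succ - y 0) / (x 0 + y j.succ)) *
          (Matrix.of fun i j => ((x ∘ Fin.succ) i + (y ∘ Fin.succ) j)⁻¹) i j) i j := by
      ext i j
      have a1 := (add_pos (hx i.succ) (hy j.succ)).ne'
      have a2 := (add_pos (hx i.succ) (hy 0)).ne'
      have a3 := (add_pos (hx 0) (hy j.succ)).ne'
      have a4 := (add_pos (hx 0) (hy 0)).ne'
      simp only [Matrix.of_apply, Function.comp]
      field_simp
      ring
    rw [this, Matrix.det_mul_column, Matrix.det_mul_row]
    refine mul_pos (Finset.prod_pos fun i _ => ?_) (mul_pos (Finset.prod_pos fun i _ => ?_) ih)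
    · exact div_pos (sub_pos.2 (hxm (Fin.succ_pos i))) (add_pos (hx _) (hy _))
    · exact div_pos (sub_pos.2 (hym (Fin.succ_pos i))) (add_pos (hx _) (hy _))

/-- A family of matrices tending to the identity, all of whose minors are positive. -/
def cauchyKernel (n : ℕ) (s : ℝ) : Matrix (Fin n) (Fin n) ℝ :=
  Matrix.of fun i j => s ^ i.val * (2 * s ^ j.val * (s ^ (2 * i.val) + s ^ (2 * j.val))⁻¹)

lemma det_cauchyKernel_submatrix_pos {n p : ℕ} {s : ℝ} (hs : 1 < s) (a b : Fin p ↪o Fin n) :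
    0 < ((cauchyKernel n s).submatrix a b).det := by
  have hs0 : 0 < s := by linarith
  have hm : ∀ a : Fin p ↪o Fin n, StrictMono fun i => s ^ (2 * (a i).val) := fun a i j hij =>
    pow_lt_pow_right₀ hs (by have : (a i).val < (a j).val := a.strictMono hij
                             omega)
  have h := det_cauchy_pos (fun i => pow_pos hs0 (2 * (a i).val))
    (fun i => pow_pos hs0 (2 * (b i).val)) (hm a) (hm b)
  have e : (cauchyKernel n s).submatrix a b = Matrix.of fun i j => s ^ (a i).val *
      (Matrix.of fun i j => (2 * s ^ (b j).val) *
        (Matrix.of fun i j => (s ^ (2 * (a i).val) + s ^ (2 * (b j).val))⁻¹) i j) i j := by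
    ext i j
    simp [cauchyKernel]
  rw [e, Matrix.det_mul_column, Matrix.det_mul_row]
  exact mul_pos (Finset.prod_pos fun i _ => by positivity)
    (mul_pos (Finset.prod_pos fun i _ => by positivity) h)

lemma tendsto_cauchyKernel (n : ℕ) :
    Filter.Tendsto (cauchyKernel n) Filter.atTop (nhds 1) := by
  refine tendsto_pi_nhds.2 fun i => tendsto_pi_nhds.2 fun j => ?_
  have key : ∀ p q : ℕ, p < q → Filter.Tendsto
      (fun s : ℝ => s ^ p * (2 * s ^ q * (s ^ (2 * p) + s ^ (2 * q))⁻¹))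
      Filter.atTop (nhds 0) := by
    intro p q hpq
    have hb : Filter.Tendsto (fun s : ℝ => 2 * s⁻¹) Filter.atTop (nhds 0) := by
      simpa using tendsto_inv_atTop_zero.const_mul (2 : ℝ)
    refine squeeze_zero' ?_ ?_ hb
    · filter_upwards [Filter.eventually_gt_atTop 1] with s hs
      have : 0 < s := by linarith
      positivity
    · filter_upwards [Filter.eventually_gt_atTop 1] with s hs
      have hs0 : 0 < s := by linarith
      have h1 : s ^ (p + 1) ≤ s ^ q := pow_le_pow_right₀ hs.le hpq
      have h2 : s ^ p * s ^ q * s ≤ s ^ (2 * p) + s ^ (2 * q) := by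
        have : s ^ p * s ^ q * s = s ^ (p + 1) * s ^ q := by ring
        rw [this, two_mul q, pow_add s q q]
        have := mul_le_mul_of_nonneg_right h1 (pow_pos hs0 q).le
        have := pow_pos hs0 (2 * p)
        linarith
      have h3 : 0 < s ^ (2 * p) + s ^ (2 * q) := by positivity
      rw [show s ^ p * (2 * s ^ q * (s ^ (2 * p) + s ^ (2 * q))⁻¹) =
        2 * ((s ^ p * s ^ q) / (s ^ (2 * p) + s ^ (2 * q))) by field_simp]
      gcongr
      rw [div_le_iff₀ h3, inv_mul_eq_div, le_div_iff₀ hs0]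
      exact h2
  rcases lt_trichotomy i.val j.val with h | h | h
  · simpa [cauchyKernel, Matrix.one_apply, Fin.ext_iff, h.ne] using key _ _ h
  · obtain rfl : i = j := Fin.ext h
    refine tendsto_const_nhds.congr' ?_
    filter_upwards [Filter.eventually_gt_atTop 0] with s hs
    have : 0 < s ^ i.val := pow_pos hs _
    simp only [cauchyKernel, Matrix.of_apply, Matrix.one_apply_eq]
    field_simp
    ring
  · have := key _ _ h
    simp only [Matrix.one_apply, Fin.ext_iff, h.ne', if_false]
    refine this.congr fun s => ?_
    simp only [cauchyKernel, Matrix.of_apply]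
    rw [add_comm (s ^ (2 * j.val))]
    ring

/-- The product of the differences `x j - x i` over all pairs `i < j`. -/
def pairProd {p : ℕ} (x : Fin p → ℝ) : ℝ :=
  ∏ i, ∏ j, if i < j then x j - x i else 1

lemma pairProd_eq_det_vandermonde {p : ℕ} (x : Fin p → ℝ) :
    pairProd x = (Matrix.vandermonde x).det := by
  rw [Matrix.det_vandermonde, pairProd]
  refine Finset.prod_congr rfl fun i _ => ?_
  rw [← Finset.prod_filter]
  congr 1
  ext j
  simp

lemma pairProd_append {k m : ℕ} (x : Fin k → ℝ) (y : Fin m → ℝ) :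
    pairProd (Fin.append x y) = pairProd x * pairProd y * ∏ i, ∏ j, (y j - x i) := by
  have h1 : ∀ (i : Fin k) (j : Fin m), Fin.castAdd m i < Fin.natAdd k j := fun i j =>
    Fin.lt_def.2 (by simp; omega)
  have h2 : ∀ (i : Fin k) (j : Fin m), ¬ Fin.natAdd k j < Fin.castAdd m i := fun i j =>
    (h1 i j).le.not_gt
  simp only [pairProd, Fin.prod_univ_add, Fin.append_left, Fin.append_right, h1, h2, if_true,
    if_false, Finset.prod_const_one, Finset.prod_mul_distrib,
    Fin.natAdd_lt_natAdd_iff, (Fin.strictMono_castAdd m).lt_iff_lt]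
  ring

lemma pairProd_pos {p : ℕ} {x : Fin p → ℝ} (hx : StrictMono x) : 0 < pairProd x :=
  Finset.prod_pos fun i _ => Finset.prod_pos fun j _ => by
    split_ifs with h
    · exact sub_pos.2 (hx h)
    · exact one_pos

lemma det_submatrix_pos {n p : ℕ} {Z : Matrix (Fin n) (Fin p) ℝ} (hZ : posMaxMinors Z)
    {a : Fin p → Fin n} (ha : StrictMono a) : 0 < (Z.submatrix a id).det := by
  have hs : (Finset.univ.image a).card = p := by
    rw [Finset.card_image_of_injective _ ha.injective]; simp
  have h := hZ _ hs
  have e := Finset.orderEmbOfFin_unique hs (f := a) (by simp) ha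
  simpa only [Finset.coe_orderIsoOfFin_apply, ← e] using h

lemma det_submatrix_mul_pairProd_pos {n p : ℕ} {Z : Matrix (Fin n) (Fin p) ℝ}
    (hZ : posMaxMinors Z) {a : Fin p → Fin n} (ha : Function.Injective a) :
    0 < (Z.submatrix a id).det * pairProd fun i => ((a i : ℕ) : ℝ) := by
  set σ := Tuple.sort a
  have hmono : StrictMono (a ∘ σ) :=
    (Tuple.monotone_sort a).strictMono_of_injective (ha.comp σ.injective)
  have h1 := det_submatrix_pos hZ hmono
  have h2 : 0 < pairProd fun i => ((a (σ i) : ℕ) : ℝ) :=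
    pairProd_pos fun i j hij => by exact_mod_cast hmono hij
  rw [pairProd_eq_det_vandermonde] at h2 ⊢
  have e1 := Matrix.det_permute σ (Z.submatrix a id)
  have e2 := Matrix.det_permute σ (Matrix.vandermonde fun i => ((a i : ℕ) : ℝ))
  rw [Matrix.submatrix_submatrix] at e1
  have e3 : (Matrix.vandermonde fun i => ((a i : ℕ) : ℝ)).submatrix σ id =
    Matrix.vandermonde fun i => ((a (σ i) : ℕ) : ℝ) := rfl
  have h3 := mul_pos h1 h2
  rw [← e3, e2] at h3
  rw [Function.id_comp] at e1
  rw [e1] at h3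
  rcases Int.units_eq_one_or (Equiv.Perm.sign σ) with h | h <;> simpa [h] using h3

lemma twist_update {k m : ℕ} [DecidableEq (Fin k)] (u : Fin m → Fin (k + m) → ℝ)
    (y : Fin k → Fin (k + m) → ℝ) (i : Fin k) (w : Fin (k + m) → ℝ) :
    twist (Function.update y i w) u =
      ((Matrix.of (Fin.append y u)).updateRow (Fin.castAdd m i) w).det := by
  unfold twist
  congr 1
  ext s t
  refine Fin.addCases (fun s => ?_) (fun s => ?_) s
  · by_cases hs : s = i
    · subst hs; simp
    · rw [Matrix.updateRow_ne (by simpa using hs)]; simp [hs]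
  · rw [Matrix.updateRow_ne (by simp [Fin.ext_iff]; omega)]; simp

/-- `twist` as an alternating form in its first `k` rows. -/
def twistForm {k m : ℕ} (u : Fin m → Fin (k + m) → ℝ) :
    (Fin (k + m) → ℝ) [⋀^Fin k]→ₗ[ℝ] ℝ where
  toFun y := twist y u
  map_update_add' y i a b := by
    simp only [twist_update, Matrix.det_updateRow_add]
  map_update_smul' y i c a := by
    simp only [twist_update, Matrix.det_updateRow_smul, smul_eq_mul]
  map_eq_zero_of_eq' y i j hij hne := by
    refine Matrix.det_zero_of_row_eq (i := Fin.castAdd m i) (j := Fin.castAdd m j)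
      (by simpa using hne) ?_
    ext t
    simp [hij]

lemma twistForm_apply {k m : ℕ} (u : Fin m → Fin (k + m) → ℝ)
    (y : Matrix (Fin k) (Fin (k + m)) ℝ) : twistForm u (fun i => y i) = twist y u := rfl

lemma twist_mul_eq_sum {k m n : ℕ} (C : Matrix (Fin k) (Fin n) ℝ)
    (Z : Matrix (Fin n) (Fin (k + m)) ℝ) (u : Fin m → Fin (k + m) → ℝ) :
    twist (C * Z) u = ∑ a : Fin k ↪o Fin n, (C.submatrix id a).det * twist (fun i => Z (a i)) u := by
  have h := alternating_sum_smul_eq (twistForm u) C (fun j => Z j)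
  have e : (fun i => ∑ j, C i j • (Z j : Fin (k + m) → ℝ)) = fun i => (C * Z) i := by
    ext i t
    simp [Matrix.mul_apply]
  rw [e, twistForm_apply] at h
  exact h

/-- Sign of the twistor coordinates of the image of a totally positive point. -/
lemma twist_mul_pos_s11 {k m n : ℕ} (hkm : k + m ≤ n) {Z : Matrix (Fin n) (Fin (k + m)) ℝ}
    (hZ : posMaxMinors Z) {C : Matrix (Fin k) (Fin n) ℝ}
    (hC : ∀ a : Fin k ↪o Fin n, 0 < (C.submatrix id a).det) {g : Fin m → Fin n}
    (hg : Function.Injective g) {ε δ : ℝ} (hε : 0 < ε * pairProd fun j => ((g j : ℕ) : ℝ))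
    (hδ : ∀ x : Fin n, (∀ j, g j ≠ x) → 0 < δ * ∏ j, (((g j : ℕ) : ℝ) - ((x : ℕ) : ℝ))) :
    0 < ε * δ ^ k * twist (C * Z) fun j => Z (g j) := by
  have hmat : ∀ a : Fin k → Fin n, Matrix.of (Fin.append (fun i => Z (a i)) fun j => Z (g j)) =
      Z.submatrix (Fin.append a g) id := fun a => by
    ext s t
    refine Fin.addCases (fun s => ?_) (fun s => ?_) s <;> simp
  have hpos : ∀ a : Fin k ↪o Fin n, (∀ i j, g j ≠ a i) →
      0 < ε * δ ^ k * twist (fun i => Z (a i)) fun j => Z (g j) := by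
    intro a ha
    have hinj : Function.Injective (Fin.append a g) :=
      Fin.append_injective_iff.2 ⟨a.injective, hg, fun i j => (ha i j).symm⟩
    have h1 := det_submatrix_mul_pairProd_pos hZ hinj
    have e : (fun i => ((Fin.append (⇑a) g i).val : ℝ)) =
        Fin.append (fun i => ((a i : ℕ) : ℝ)) fun j => ((g j : ℕ) : ℝ) := by
      ext s
      refine Fin.addCases (fun s => ?_) (fun s => ?_) s <;> simp
    rw [e, pairProd_append] at h1
    have h2 : 0 < pairProd fun i => ((a i : ℕ) : ℝ) :=
      pairProd_pos fun i j hij => by exact_mod_cast a.strictMono hij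
    have h3 : 0 < δ ^ k * ∏ i, ∏ j, (((g j : ℕ) : ℝ) - ((a i : ℕ) : ℝ)) := by
      have : δ ^ k = ∏ _i : Fin k, δ := by simp
      rw [this, ← Finset.prod_mul_distrib]
      exact Finset.prod_pos fun i _ => hδ _ (ha i)
    unfold twist
    rw [hmat]
    set D := (Z.submatrix (Fin.append a g) id).det
    set A := pairProd fun i => ((a i : ℕ) : ℝ)
    set B := pairProd fun i => ((g i : ℕ) : ℝ)
    set P := ∏ i, ∏ j, (((g j : ℕ) : ℝ) - ((a i : ℕ) : ℝ))
    have h4 : 0 < (ε * δ ^ k * D) * (D * (A * B * P)) ^ 2 * 1 := by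
      have hD : D ≠ 0 := fun h => by simp [h] at h1
      have : (ε * δ ^ k * D) * (D * (A * B * P)) ^ 2 * 1 =
        (ε * B) * (δ ^ k * P) * A * D ^ 2 * (D * (A * B * P)) := by ring
      rw [this]
      positivity
    rw [mul_one] at h4
    exact pos_of_mul_pos_left h4 (sq_nonneg _)
  have hzero : ∀ a : Fin k ↪o Fin n, (¬ ∀ i j, g j ≠ a i) →
      twist (fun i => Z (a i)) (fun j => Z (g j)) = 0 := by
    intro a ha
    push Not at ha
    obtain ⟨i, j, hij⟩ := ha
    refine Matrix.det_zero_of_row_eq (i := Fin.castAdd m i) (j := Fin.natAdd k j)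
      (by simp [Fin.ext_iff]; omega) ?_
    ext t
    simp [hij]
  rw [twist_mul_eq_sum, Finset.mul_sum]
  refine Finset.sum_pos' (fun a _ => ?_) ?_
  · by_cases ha : ∀ i j, g j ≠ a i
    · rw [mul_left_comm]
      exact (mul_pos (hC a) (hpos a ha)).le
    · rw [hzero a ha]; simp
  · obtain ⟨s, hs, hcard⟩ := Finset.exists_subset_card_eq
      (s := (Finset.univ.image g)ᶜ) (n := k) (by
        rw [Finset.card_compl, Finset.card_image_of_injective _ hg]; simp; omega)
    refine ⟨s.orderEmbOfFin hcard, Finset.mem_univ _, ?_⟩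
    rw [mul_left_comm]
    refine mul_pos (hC _) (hpos _ fun i j hij => ?_)
    have := hs (s.orderEmbOfFin_mem hcard i)
    rw [← hij] at this
    simp at this

/-- If an alternating form is positive on all increasing subfamilies of `c`, then the coefficients
of any nontrivial relation between the vectors of `c` modulo the radical of the form change sign at
least `k` times. -/
lemma exists_alternating_chain {E : Type*} [AddCommGroup E] [Module ℝ E] :
    ∀ {n k : ℕ} (ω : E [⋀^Fin k]→ₗ[ℝ] ℝ) (c : Fin n → E) (v : Fin n → ℝ), k ≤ n →
      (∀ f : Fin k → Fin n, StrictMono f → 0 < ω (c ∘ f)) →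
      (∀ (x : Fin k → E) (i : Fin k), x i = ∑ j, v j • c j → ω x = 0) → v ≠ 0 →
      ∃ f : Fin (k + 1) → Fin n, StrictMono f ∧ v (f 0) ≠ 0 ∧
        ∀ j : Fin k, v (f j.castSucc) * v (f j.succ) < 0
  | n, 0, _, _, v, _, _, _, hv => by
    obtain ⟨i, hi⟩ := Function.ne_iff.1 hv
    exact ⟨fun _ => i, fun i j h => absurd h (by omega), hi, fun j => j.elim0⟩
  | 0, k + 1, _, _, _, hkn, _, _, _ => by omega
  | n + 1, k + 1, ω, c, v, hkn, hpos, hker, hv => by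
    by_cases hn : k = n
    · subst hn
      obtain ⟨i, hi⟩ := Function.ne_iff.1 hv
      exfalso
      have h1 := hpos id strictMono_id
      have h2 := hker (Function.update c i (∑ j, v j • c j)) i (by simp)
      rw [ω.map_update_sum, Finset.sum_eq_single i] at h2
      · rw [ω.map_update_smul, Function.update_eq_self] at h2
        exact (mul_ne_zero hi h1.ne') h2
      · intro j _ hji
        rw [ω.map_update_smul, ω.map_update_self _ hji.symm, smul_zero]
      · simp
    obtain ⟨n, rfl⟩ : ∃ n', n = n' + 1 := ⟨n - 1, by omega⟩
    by_cases hv1 : v 1 = 0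
    · obtain ⟨f, hf, hf0, hf'⟩ := exists_alternating_chain ω (c ∘ Fin.succAbove 1)
        (v ∘ Fin.succAbove 1) (by omega)
        (fun f hf => hpos (Fin.succAbove 1 ∘ f) ((Fin.strictMono_succAbove 1).comp hf))
        (fun x i hx => hker x i (by
          rw [Fin.sum_univ_succAbove (fun j => v j • c j) 1, hv1, zero_smul, zero_add, hx]; rfl))
        (fun h => hv (by
          ext i
          refine Fin.succAboveCases 1 hv1 (fun i => congrFun h i) i))
      exact ⟨Fin.succAbove 1 ∘ f, (Fin.strictMono_succAbove 1).comp hf, hf0, hf'⟩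
    have hv' : v ∘ Fin.succ ≠ 0 := fun h => hv1 (congrFun h 0)
    by_cases hv01 : 0 ≤ v 0 * v 1
    · have ha : 0 ≤ v 0 / v 1 := by
        rw [div_eq_mul_inv, ← div_self_mul_self', mul_div_assoc']
        exact div_nonneg hv01 (mul_self_nonneg _)
      set c' : Fin (n + 1) → E := Function.update (c ∘ Fin.succ) 0 (c 1 + (v 0 / v 1) • c 0)
        with hc'
      have hc0 : c' 0 = c 1 + (v 0 / v 1) • c 0 := by simp [hc']
      have hcs : ∀ i : Fin n, c' i.succ = c i.succ.succ := fun i => by simp [hc']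
      have hcne : ∀ i : Fin (n + 1), i ≠ 0 → c' i = c i.succ := fun i hi => by simp [hc', hi]
      have hpos' : ∀ f : Fin (k + 1) → Fin (n + 1), StrictMono f → 0 < ω (c' ∘ f) := by
        intro f hf
        by_cases h0 : f 0 = 0
        · have hne : ∀ i : Fin k, f i.succ ≠ 0 := fun i h => by
            have := hf (Fin.succ_pos i)
            rw [h0, h] at this
            exact lt_irrefl _ this
          have e1 : c' ∘ f = Function.update (c ∘ Fin.succ ∘ f) 0 (c 1 + (v 0 / v 1) • c 0) := by
            ext i
            refine Fin.cases ?_ (fun i => ?_) i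
            · simp [h0, hc0]
            · simp [hcne _ (hne i)]
          have e2 : Function.update (c ∘ Fin.succ ∘ f) 0 (c 1) = c ∘ Fin.succ ∘ f := by
            rw [Function.update_eq_self_iff]
            simp [h0]
          have e3 : Function.update (c ∘ Fin.succ ∘ f) 0 (c 0) =
              c ∘ Fin.cons 0 (fun i : Fin k => (f i.succ).succ) := by
            ext i
            refine Fin.cases ?_ (fun i => ?_) i <;> simp
          rw [e1, ω.map_update_add, ω.map_update_smul, e2, e3]
          refine add_pos_of_pos_of_nonneg (hpos _ (Fin.strictMono_succ.comp hf))
            (mul_nonneg ha (hpos _ ?_).le)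
          exact Fin.strictMono_cons.2 ⟨fun i => Fin.succ_pos _,
            (Fin.strictMono_succ.comp hf).comp Fin.strictMono_succ⟩
        · have e1 : c' ∘ f = c ∘ Fin.succ ∘ f := by
            ext i
            refine hcne _ fun hi => h0 ?_
            have := hf.monotone (Fin.zero_le i)
            rw [hi] at this
            exact le_antisymm this (Fin.zero_le _)
          rw [e1]
          exact hpos _ (Fin.strictMono_succ.comp hf)
      have hker' : ∀ (x : Fin (k + 1) → E) (i : Fin (k + 1)),
          x i = ∑ j, (v ∘ Fin.succ) j • c' j → ω x = 0 := by
        intro x i hx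
        refine hker x i ?_
        rw [hx, Fin.sum_univ_succ, Fin.sum_univ_succ (n := n + 1), Fin.sum_univ_succ (n := n)]
        simp only [hc0, hcs, Function.comp, Fin.succ_zero_eq_one, smul_add, smul_smul,
          mul_div_cancel₀ _ hv1]
        abel
      obtain ⟨f, hf, hf0, hf'⟩ := exists_alternating_chain ω c' (v ∘ Fin.succ) (by omega)
        hpos' hker' hv'
      exact ⟨Fin.succ ∘ f, Fin.strictMono_succ.comp hf, hf0, hf'⟩
    · push Not at hv01
      have hpos' : ∀ f : Fin k → Fin (n + 1), StrictMono f →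
          0 < ω.curryLeft (c 0) ((c ∘ Fin.succ) ∘ f) := by
        intro f hf
        rw [AlternatingMap.curryLeft_apply_apply]
        have := hpos (Fin.cons 0 (Fin.succ ∘ f))
          (Fin.strictMono_cons.2 ⟨fun i => Fin.succ_pos _, Fin.strictMono_succ.comp hf⟩)
        convert this using 2
        ext i
        refine Fin.cases ?_ (fun i => ?_) i <;> simp
      have hker' : ∀ (x : Fin k → E) (i : Fin k),
          x i = ∑ j, (v ∘ Fin.succ) j • (c ∘ Fin.succ) j → ω.curryLeft (c 0) x = 0 := by
        intro x i hx
        rw [AlternatingMap.curryLeft_apply_apply]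
        have e : Matrix.vecCons (c 0) x = Function.update (Matrix.vecCons (c 0) x) i.succ
            (∑ j, v j • c j + (- v 0) • c 0) := by
          rw [eq_comm, Function.update_eq_self_iff]
          rw [Fin.sum_univ_succ]
          simp [hx]
        rw [e, ω.map_update_add, ω.map_update_smul, hker _ i.succ (by simp),
          ω.map_eq_zero_of_eq (i := 0) (j := i.succ) _
            (by simp [Function.update_of_ne (Fin.succ_ne_zero i).symm]) (Fin.succ_ne_zero i).symm]
        simp
      obtain ⟨f, hf, hf0, hf'⟩ := exists_alternating_chain (ω.curryLeft (c 0)) (c ∘ Fin.succ)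
        (v ∘ Fin.succ) (by omega) hpos' hker' hv'
      have hcons : ∀ i : Fin (n + 2), i < (f 0).succ → v i * v (f 0).succ < 0 →
          ∃ f : Fin (k + 1 + 1) → Fin (n + 2), StrictMono f ∧ v (f 0) ≠ 0 ∧
            ∀ j : Fin (k + 1), v (f j.castSucc) * v (f j.succ) < 0 := by
        intro i hi hneg
        refine ⟨Fin.cons i (Fin.succ ∘ f), Fin.strictMono_cons.2
          ⟨fun j => hi.trans_le ?_, Fin.strictMono_succ.comp hf⟩, ?_, ?_⟩
        · exact Fin.succ_le_succ_iff.2 (hf.monotone (Fin.zero_le j))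
        · exact left_ne_zero_of_mul hneg.ne
        · intro j
          refine Fin.cases ?_ (fun j => ?_) j
          · simpa using hneg
          · simpa using hf' j
      by_cases hneg : v 0 * v (f 0).succ < 0
      · exact hcons 0 (Fin.succ_pos _) hneg
      · have h0 : v 0 ≠ 0 := left_ne_zero_of_mul hv01.ne
        have hp : 0 < v 0 * v (f 0).succ :=
          lt_of_le_of_ne (not_lt.1 hneg) (mul_ne_zero h0 hf0).symm
        have hneg' : v 1 * v (f 0).succ < 0 := by
          by_contra! h
          have h1 := mul_pos_of_neg_of_neg hv01 (neg_neg_of_pos hp)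
          have h2 := mul_nonneg h (sq_nonneg (v 0))
          nlinarith
        refine hcons 1 ?_ hneg'
        rw [← Fin.succ_zero_eq_one, Fin.succ_lt_succ_iff]
        refine Fin.pos_iff_ne_zero.2 fun h => ?_
        rw [h, Fin.succ_zero_eq_one] at hneg'
        exact (mul_self_nonneg _).not_gt hneg'
termination_by n => n

lemma twist_update_right {k m : ℕ} (Y : Matrix (Fin k) (Fin (k + m)) ℝ)
    (u : Fin m → Fin (k + m) → ℝ) (j : Fin m) (w : Fin (k + m) → ℝ) :
    twist Y (Function.update u j w) =
      ((Matrix.of (Fin.append (fun i => Y i) u)).updateRow (Fin.natAdd k j) w).det := by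
  unfold twist
  congr 1
  ext s t
  refine Fin.addCases (fun s => ?_) (fun s => ?_) s
  · rw [Matrix.updateRow_ne (by simp [Fin.ext_iff]; omega)]; simp
  · by_cases hs : s = j
    · subst hs; simp
    · rw [Matrix.updateRow_ne (by simpa using hs)]; simp [hs]

/-- `twist` as a linear form in one of its last `m` rows. -/
def twistLinear {k m : ℕ} (Y : Matrix (Fin k) (Fin (k + m)) ℝ)
    (u : Fin m → Fin (k + m) → ℝ) (j : Fin m) : (Fin (k + m) → ℝ) →ₗ[ℝ] ℝ where
  toFun w := twist Y (Function.update u j w)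
  map_add' a b := by simp only [twist_update_right, Matrix.det_updateRow_add]
  map_smul' c a := by
    simp only [twist_update_right, Matrix.det_updateRow_smul, smul_eq_mul, RingHom.id_apply]

lemma twistLinear_left {k m : ℕ} (Y : Matrix (Fin k) (Fin (k + m)) ℝ)
    (u : Fin m → Fin (k + m) → ℝ) (j : Fin m) (i : Fin k) : twistLinear Y u j (Y i) = 0 := by
  refine Matrix.det_zero_of_row_eq (i := Fin.castAdd m i) (j := Fin.natAdd k j)
    (by simp [Fin.ext_iff]; omega) ?_
  ext t
  simp

lemma twistLinear_right {k m : ℕ} (Y : Matrix (Fin k) (Fin (k + m)) ℝ)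
    (u : Fin m → Fin (k + m) → ℝ) {j s : Fin m} (h : s ≠ j) : twistLinear Y u j (u s) = 0 := by
  refine Matrix.det_zero_of_row_eq (i := Fin.natAdd k s) (j := Fin.natAdd k j)
    (by simpa using h) ?_
  ext t
  simp [h]

/-- The values of a linear form on `p + 1` of the rows of `Z` satisfy the linear relation given by
the maximal minors. -/
lemma sum_linearForm_mul_minor_eq_zero {n p : ℕ} (Z : Matrix (Fin n) (Fin p) ℝ)
    (φ : (Fin p → ℝ) →ₗ[ℝ] ℝ) (h : Fin (p + 1) → Fin n) :
    ∑ i : Fin (p + 1), (-1) ^ (i : ℕ) * φ (Z (h i)) *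
      (Z.submatrix (h ∘ i.succAbove) id).det = 0 := by
  set M : Matrix (Fin (p + 1)) (Fin (p + 1)) ℝ :=
    Matrix.of fun i => Fin.cons (φ (Z (h i))) (Z (h i)) with hM
  have hdet : M.det = 0 := by
    rw [← Matrix.exists_mulVec_eq_zero_iff]
    refine ⟨Fin.cons (-1) fun l => φ (Pi.single l 1), fun h0 => ?_, ?_⟩
    · simpa using congrFun h0 0
    · ext i
      rw [Matrix.mulVec, dotProduct, Fin.sum_univ_succ]
      have e : ∀ l : Fin p, (fun j : Fin p => if l = j then (1 : ℝ) else 0) = Pi.single l 1 := fun l => by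
        ext j
        simp [Pi.single_apply, eq_comm]
      have := φ.pi_apply_eq_sum_univ (Z (h i))
      simp only [hM, Matrix.of_apply, Fin.cons_zero, Fin.cons_succ, Pi.zero_apply]
      simp [this, e]
  rw [Matrix.det_succ_column_zero] at hdet
  rw [← hdet]
  refine Finset.sum_congr rfl fun i _ => ?_
  congr 2

lemma not_alternating_linearForm {n p : ℕ} {Z : Matrix (Fin n) (Fin p) ℝ} (hZ : posMaxMinors Z)
    (φ : (Fin p → ℝ) →ₗ[ℝ] ℝ) {h : Fin (p + 1) → Fin n} (hh : StrictMono h) (r : Fin (p + 1))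
    (hzero : ∀ i < r, φ (Z (h i)) = 0) (hr : φ (Z (h r)) ≠ 0)
    (halt : ∀ i : Fin p, r ≤ i.castSucc → φ (Z (h i.castSucc)) * φ (Z (h i.succ)) < 0) :
    False := by
  have hsign : ∀ i : Fin (p + 1), r ≤ i →
      0 < ((-1) ^ (r : ℕ) * φ (Z (h r))) * ((-1) ^ (i : ℕ) * φ (Z (h i))) := by
    have hbase : 0 < ((-1) ^ (r : ℕ) * φ (Z (h r))) * ((-1) ^ (r : ℕ) * φ (Z (h r))) :=
      mul_self_pos.2 (mul_ne_zero (by simp) hr)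
    intro i
    induction i using Fin.induction with
    | zero =>
      intro hi
      obtain rfl : r = 0 := le_antisymm hi (Fin.zero_le _)
      exact hbase
    | succ i ih =>
      intro hi
      rcases hi.eq_or_lt with rfl | hlt
      · exact hbase
      · have hle : r ≤ i.castSucc := by
          rw [Fin.le_def]; rw [Fin.lt_def] at hlt; simp at hlt ⊢; omega
        have h1 := ih hle
        have h2 := halt i hle
        rw [Fin.val_castSucc] at h1
        rw [Fin.val_succ, pow_succ]
        set a := (-1) ^ (r : ℕ) * φ (Z (h r))
        set b := φ (Z (h i.castSucc))
        set c := φ (Z (h i.succ))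
        have hs : ((-1 : ℝ) ^ (i : ℕ)) ^ 2 = 1 := by
          rw [← pow_mul, mul_comm, pow_mul]; simp
        have h3 := mul_pos h1 (neg_pos.2 h2)
        have h4 : a * ((-1) ^ (i : ℕ) * b) * -(b * c) =
          (a * ((-1) ^ (i : ℕ) * -1 * c)) * b ^ 2 := by ring
        rw [h4] at h3
        exact pos_of_mul_pos_left h3 (sq_nonneg b)
  have h0 := sum_linearForm_mul_minor_eq_zero Z φ h
  have hpos : 0 < ∑ i : Fin (p + 1), ((-1) ^ (r : ℕ) * φ (Z (h r))) *
      ((-1) ^ (i : ℕ) * φ (Z (h i)) * (Z.submatrix (h ∘ i.succAbove) id).det) := by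
    have hd : ∀ i : Fin (p + 1), 0 < (Z.submatrix (h ∘ i.succAbove) id).det := fun i =>
      det_submatrix_pos hZ (hh.comp (Fin.strictMono_succAbove i))
    refine Finset.sum_pos' (fun i _ => ?_) ⟨r, Finset.mem_univ _, ?_⟩
    · rcases lt_or_ge i r with hi | hi
      · simp [hzero i hi]
      · rw [← mul_assoc]
        exact (mul_pos (hsign i hi) (hd i)).le
    · rw [← mul_assoc]
      exact mul_pos (hsign r le_rfl) (hd r)
  rw [← Finset.mul_sum, h0, mul_zero] at hpos
  exact lt_irrefl _ hpos

lemma signChanges_twist_eq {k m n : ℕ} (hk : 0 < k) (hm : 1 ≤ m) (hkm : k + m ≤ n)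
    {Z : Matrix (Fin n) (Fin (k + m)) ℝ} (hZ : posMaxMinors Z) {C : Matrix (Fin k) (Fin n) ℝ}
    (hC : ∀ a : Fin k ↪o Fin n, 0 < (C.submatrix id a).det)
    (hne : twist (C * Z) (fun t : Fin m => Z ⟨t.val, by omega⟩) ≠ 0) :
    signChanges (fun j : Fin (n - m + 1) =>
      twist (C * Z) (fun t : Fin m =>
        if _ht : t.val < m - 1 then Z ⟨t.val, by omega⟩
        else Z ⟨m - 1 + j.val, by have := j.isLt; omega⟩)) = k := by
  set u : Fin m → Fin (k + m) → ℝ := fun t => Z ⟨t.val, by omega⟩ with hu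
  have hlast : m - 1 < m := by omega
  set φ := twistLinear (C * Z) u ⟨m - 1, by omega⟩ with hφ
  have hφzero : ∀ x : Fin n, x.val < m - 1 → φ (Z x) = 0 := fun x hx =>
    twistLinear_right (C * Z) u (s := ⟨x.val, by omega⟩) (by simp [Fin.ext_iff]; omega)
  have hseq : ∀ j : Fin (n - m + 1), twist (C * Z) (fun t : Fin m =>
        if _ht : t.val < m - 1 then Z ⟨t.val, by omega⟩
        else Z ⟨m - 1 + j.val, by have := j.isLt; omega⟩) =
      φ (Z ⟨m - 1 + j.val, by have := j.isLt; omega⟩) := fun j => by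
    change _ = twist (C * Z) (Function.update u ⟨m - 1, by omega⟩ _)
    congr 1
    ext t : 1
    by_cases ht : t.val < m - 1
    · rw [Function.update_of_ne (by simp [Fin.ext_iff]; omega), dif_pos ht]
    · have ht' : (⟨m - 1, hlast⟩ : Fin m) = t := Fin.ext (by simp; omega)
      subst ht'
      rw [dif_neg ht, Function.update_self]
  simp only [hseq]
  refine IsGreatest.csSup_eq ⟨?_, ?_⟩
  · obtain ⟨f, hf, hf0, hf'⟩ := exists_alternating_chain
      (Matrix.detRowAlternating (n := Fin k) (R := ℝ)) (fun j i => C i j) (fun j => φ (Z j))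
      (by omega)
      (fun f hf => by
        have := hC (OrderEmbedding.ofStrictMono f hf)
        rw [← Matrix.det_transpose] at this
        exact this)
      (fun x i hx => by
        refine AlternatingMap.map_coord_zero _ i ?_
        rw [hx]
        ext s
        have h1 : φ ((C * Z) s) = 0 := twistLinear_left _ _ _ s
        have h2 : (C * Z) s = ∑ j, C s j • Z j := by
          ext t
          simp [Matrix.mul_apply]
        rw [h2, map_sum] at h1
        rw [Pi.zero_apply, ← h1, Finset.sum_apply]
        refine Finset.sum_congr rfl fun j _ => ?_
        simp [mul_comm])
      (fun h0 => hne (by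
        have h1 : twist (C * Z) (Function.update u ⟨m - 1, by omega⟩ (u ⟨m - 1, by omega⟩)) = 0 :=
          congrFun h0 (⟨m - 1, by omega⟩ : Fin n)
        rwa [Function.update_eq_self] at h1))
    have hfne : ∀ j, φ (Z (f j)) ≠ 0 := fun j => by
      refine Fin.cases hf0 (fun j => ?_) j
      exact right_ne_zero_of_mul (hf' j).ne
    have hle : ∀ j, m - 1 ≤ (f j).val := fun j => by
      by_contra! h
      exact hfne j (hφzero _ h)
    have hback : ∀ j, (⟨m - 1 + ((f j).val - (m - 1)), by
        have := hle j; have := (f j).isLt; omega⟩ : Fin n) = f j := fun j =>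
      Fin.ext (by have := hle j; simp; omega)
    refine ⟨fun j => ⟨(f j).val - (m - 1), by have := (f j).isLt; omega⟩, fun i j hij => ?_,
      fun j => ?_⟩
    · have h1 : (f i).val < (f j).val := hf hij
      have := hle i
      rw [Fin.lt_def]
      simp only
      omega
    · simp only [hback]
      exact hf' j
  · rintro q ⟨f, hf, hf'⟩
    by_contra! hq
    have hfne : ∀ j, φ (Z ⟨m - 1 + (f j).val, by have := (f j).isLt; omega⟩) ≠ 0 := fun j => by
      refine Fin.lastCases ?_ (fun j => ?_) j
      · obtain ⟨q, rfl⟩ : ∃ q', q = q' + 1 := ⟨q - 1, by omega⟩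
        exact right_ne_zero_of_mul (hf' (Fin.last q)).ne
      · exact left_ne_zero_of_mul (hf' j).ne
    set h : Fin (k + m + 1) → Fin n := fun i =>
      if hi : i.val < m - 1 then ⟨i.val, by omega⟩
      else ⟨m - 1 + (f ⟨i.val - (m - 1), by omega⟩).val, by
        have := (f ⟨i.val - (m - 1), by omega⟩).isLt; omega⟩ with hh
    refine not_alternating_linearForm hZ φ (h := h) ?_ ⟨m - 1, by omega⟩ ?_ ?_ ?_
    · intro i j hij
      rw [Fin.lt_def] at hij ⊢
      by_cases hi : i.val < m - 1
      · by_cases hj : j.val < m - 1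
        · simpa [hh, hi, hj] using hij
        · simp only [hh, hi, hj, dif_pos, dif_neg, not_false_iff]
          omega
      · have hj : ¬ j.val < m - 1 := by omega
        simp only [hh, hi, hj, dif_neg, not_false_iff]
        have : (f ⟨i.val - (m - 1), by omega⟩).val < (f ⟨j.val - (m - 1), by omega⟩).val :=
          hf (by rw [Fin.lt_def]; simp only; omega)
        omega
    · intro i hi
      rw [Fin.lt_def] at hi
      simp only at hi
      simp only [hh, hi, dif_pos]
      exact hφzero _ hi
    · simp only [hh, lt_irrefl, dif_neg, not_false_iff]
      exact hfne _
    · intro i hi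
      rw [Fin.le_def] at hi
      simp only [Fin.val_castSucc] at hi
      have h1 : ¬ i.castSucc.val < m - 1 := by simpa using hi
      have h2 : ¬ i.succ.val < m - 1 := by simp; omega
      simp only [hh, h1, h2, dif_neg, not_false_iff]
      have h3 := hf' ⟨i.val - (m - 1), by omega⟩
      have e : i.val + 1 - (m - 1) = i.val - (m - 1) + 1 := by omega
      simp only [Fin.val_succ, e]
      exact h3

lemma prod_pos_of_pairs {m : ℕ} (hm : m % 2 = 0) (G : Fin m → ℝ)
    (h : ∀ (t : ℕ) (ht : 2 * t + 1 < m), 0 < G ⟨2 * t, by omega⟩ * G ⟨2 * t + 1, ht⟩) :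
    0 < ∏ j, G j := by
  obtain ⟨r, rfl⟩ : ∃ r, m = 2 * r := ⟨m / 2, by omega⟩
  induction r with
  | zero => simp
  | succ r ih =>
    have e : ∏ j : Fin (2 * (r + 1)), G j = (∏ j : Fin (2 * r), G ⟨j.val, by omega⟩) *
        (G ⟨2 * r, by omega⟩ * G ⟨2 * r + 1, by omega⟩) := by
      rw [← mul_assoc]
      exact (Fin.prod_univ_castSucc (n := 2 * r + 1) G).trans
        (congrArg (· * _) (Fin.prod_univ_castSucc (n := 2 * r) _))
    rw [e]
    exact mul_pos (ih (by omega) _ fun t ht => h t (by omega)) (h r (by omega))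

lemma sub_mul_sub_pos_of_consecutive {a b x : ℕ} (hab : b = a + 1) (ha : a ≠ x) (hb : b ≠ x) :
    0 < ((a : ℝ) - x) * ((b : ℝ) - x) := by
  rcases lt_or_gt_of_ne ha with h | h
  · have h1 : (a : ℝ) < x := by exact_mod_cast h
    have h2 : (b : ℝ) < x := by exact_mod_cast (show b < x by omega)
    exact mul_pos_of_neg_of_neg (by linarith) (by linarith)
  · have h1 : (x : ℝ) < a := by exact_mod_cast h
    have h2 : (x : ℝ) < b := by exact_mod_cast (show x < b by omega)
    exact mul_pos (by linarith) (by linarith)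

lemma pairProd_castSucc {p : ℕ} (x : Fin (p + 1) → ℝ) :
    pairProd x = pairProd (x ∘ Fin.castSucc) * ∏ i : Fin p, (x (Fin.last p) - x i.castSucc) := by
  have h : ∀ j : Fin p, ¬ Fin.last p < j.castSucc := fun j => (Fin.castSucc_lt_last j).le.not_gt
  simp [pairProd, Fin.prod_univ_castSucc, Fin.castSucc_lt_last, h, Finset.prod_mul_distrib]

lemma pairProd_val_pos {m n : ℕ} {g : Fin m → Fin n} (hg : StrictMono g) :
    0 < pairProd fun j => ((g j : ℕ) : ℝ) :=
  pairProd_pos fun i j hij => by exact_mod_cast hg hij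

lemma twist_initial_ne_zero {k m n : ℕ} (hkm : k + m ≤ n)
    {Z : Matrix (Fin n) (Fin (k + m)) ℝ} (hZ : posMaxMinors Z)
    {C : Matrix (Fin k) (Fin n) ℝ} (hC : ∀ a : Fin k ↪o Fin n, 0 < (C.submatrix id a).det) :
    twist (C * Z) (fun t : Fin m => Z ⟨t.val, by omega⟩) ≠ 0 := by
  have h := twist_mul_pos_s11 hkm hZ hC (g := fun t : Fin m => ⟨t.val, by omega⟩)
    (fun i j hij => by simpa [Fin.ext_iff] using hij) (ε := 1) (δ := (-1) ^ m) (by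
      rw [one_mul]
      exact pairProd_val_pos fun i j hij => hij)
    (fun x hx => by
      have hxm : ∀ j : Fin m, (j.val : ℝ) < (x.val : ℝ) := fun j => by
        have : m ≤ x.val := by
          by_contra! h
          exact hx ⟨x.val, h⟩ rfl
        exact_mod_cast lt_of_lt_of_le j.isLt this
      have e : (-1 : ℝ) ^ m = ∏ _j : Fin m, (-1 : ℝ) := by simp
      rw [e, ← Finset.prod_mul_distrib]
      exact Finset.prod_pos fun j _ => by have := hxm j; simp only; linarith)
  exact right_ne_zero_of_mul h.ne'

lemma twist_pos_of_pairs {k m n : ℕ} (hkm : k + m ≤ n)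
    {Z : Matrix (Fin n) (Fin (k + m)) ℝ} (hZ : posMaxMinors Z)
    {C : Matrix (Fin k) (Fin n) ℝ} (hC : ∀ a : Fin k ↪o Fin n, 0 < (C.submatrix id a).det)
    {g : Fin m → Fin n} (hg : StrictMono g) (hm : m % 2 = 0)
    (hpair : ∀ (t : ℕ) (ht : 2 * t + 1 < m),
      (g ⟨2 * t + 1, ht⟩).val = (g ⟨2 * t, by omega⟩).val + 1) :
    0 < twist (C * Z) fun j => Z (g j) := by
  have h := twist_mul_pos_s11 hkm hZ hC hg.injective (ε := 1) (δ := 1)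
    (by rw [one_mul]; exact pairProd_val_pos hg)
    (fun x hx => by
      rw [one_mul]
      refine prod_pos_of_pairs hm _ fun t ht => ?_
      exact sub_mul_sub_pos_of_consecutive (hpair t ht) (fun h => hx _ (Fin.ext h))
        (fun h => hx _ (Fin.ext h)))
  simpa using h

lemma twist_pos_of_first_pairs {k m n : ℕ} (hkm : k + (m + 1) ≤ n)
    {Z : Matrix (Fin n) (Fin (k + (m + 1))) ℝ} (hZ : posMaxMinors Z)
    {C : Matrix (Fin k) (Fin n) ℝ} (hC : ∀ a : Fin k ↪o Fin n, 0 < (C.submatrix id a).det)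
    {g : Fin (m + 1) → Fin n} (hg : StrictMono g) (hm : m % 2 = 0) (h0 : (g 0).val = 0)
    (hpair : ∀ (t : ℕ) (ht : 2 * t + 2 < m + 1),
      (g ⟨2 * t + 2, ht⟩).val = (g ⟨2 * t + 1, by omega⟩).val + 1) :
    0 < (-1) ^ k * twist (C * Z) fun j => Z (g j) := by
  have h := twist_mul_pos_s11 hkm hZ hC hg.injective (ε := 1) (δ := -1)
    (by rw [one_mul]; exact pairProd_val_pos hg)
    (fun x hx => by
      rw [Fin.prod_univ_succ, h0, ← mul_assoc]
      refine mul_pos ?_ (prod_pos_of_pairs hm _ fun t ht => ?_)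
      · have h1 : 0 < x.val := Nat.pos_of_ne_zero fun h => hx 0 (Fin.ext (h0.trans h.symm))
        have : (0 : ℝ) < x.val := by exact_mod_cast h1
        simpa using this
      · exact sub_mul_sub_pos_of_consecutive (hpair t (by omega)) (fun h => hx _ (Fin.ext h))
          (fun h => hx _ (Fin.ext h)))
  simpa using h

lemma twist_pos_of_pairs_last {k m n : ℕ} (hkm : k + (m + 1) ≤ n)
    {Z : Matrix (Fin n) (Fin (k + (m + 1))) ℝ} (hZ : posMaxMinors Z)
    {C : Matrix (Fin k) (Fin n) ℝ} (hC : ∀ a : Fin k ↪o Fin n, 0 < (C.submatrix id a).det)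
    {g : Fin (m + 1) → Fin n} (hg : StrictMono g) (hm : m % 2 = 0)
    (hlast : (g (Fin.last m)).val = n - 1)
    (hpair : ∀ (t : ℕ) (ht : 2 * t + 1 < m),
      (g ⟨2 * t + 1, by omega⟩).val = (g ⟨2 * t, by omega⟩).val + 1) :
    0 < twist (C * Z) fun j => Z (g j) := by
  have h := twist_mul_pos_s11 hkm hZ hC hg.injective (ε := 1) (δ := 1)
    (by rw [one_mul]; exact pairProd_val_pos hg)
    (fun x hx => by
      rw [Fin.prod_univ_castSucc, one_mul]
      refine mul_pos (prod_pos_of_pairs hm _ fun t ht => ?_) ?_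
      · exact sub_mul_sub_pos_of_consecutive (hpair t ht) (fun h => hx _ (Fin.ext h))
          (fun h => hx _ (Fin.ext h))
      · have h1 : x.val < (g (Fin.last m)).val := by
          have := x.isLt
          have : x.val ≠ (g (Fin.last m)).val := fun h => hx _ (Fin.ext h.symm)
          omega
        have : (x.val : ℝ) < (g (Fin.last m)).val := by exact_mod_cast h1
        linarith)
  simpa using h

lemma twist_pos_of_pairs_wrap {k m n : ℕ} (hkm : k + (m + 2) ≤ n)
    {Z : Matrix (Fin n) (Fin (k + (m + 2))) ℝ} (hZ : posMaxMinors Z)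
    {C : Matrix (Fin k) (Fin n) ℝ} (hC : ∀ a : Fin k ↪o Fin n, 0 < (C.submatrix id a).det)
    {g : Fin m → Fin n} (hg : StrictMono g) (hm : m % 2 = 0)
    (hpair : ∀ (t : ℕ) (ht : 2 * t + 1 < m),
      (g ⟨2 * t + 1, ht⟩).val = (g ⟨2 * t, by omega⟩).val + 1)
    (hmem : ∀ t, 1 ≤ (g t).val ∧ (g t).val ≤ n - 2) :
    0 < twist (C * Z) (fun j : Fin (m + 2) =>
      if hj : j.val < m then Z (g ⟨j.val, hj⟩)
      else if j.val = m then Z ⟨n - 1, by omega⟩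
      else ((-1 : ℝ) ^ (k + m + 1)) • Z ⟨0, by omega⟩) := by
  set w : Fin (m + 2) → Fin n := fun j =>
    if hj : j.val < m then g ⟨j.val, hj⟩
    else if j.val = m then ⟨n - 1, by omega⟩ else ⟨0, by omega⟩ with hw
  have hw1 : ∀ j : Fin m, w j.castSucc.castSucc = g j := fun j => by simp [hw]
  have hw2 : (w (Fin.last m).castSucc).val = n - 1 := by simp [hw]
  have hw3 : (w (Fin.last (m + 1))).val = 0 := by simp [hw]
  have hmono : StrictMono (w ∘ Fin.castSucc) := by
    intro i j hij
    rw [Fin.lt_def]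
    induction i using Fin.lastCases with
    | last => exact absurd hij (Fin.le_last j).not_gt
    | cast i =>
      induction j using Fin.lastCases with
      | last =>
        simp only [Function.comp, hw1, hw2]
        have := hmem i
        omega
      | cast j =>
        simp only [Function.comp, hw1]
        exact hg (by simpa using hij)
  have hwpos : ∀ i : Fin (m + 1), 0 < (w i.castSucc).val := fun i => by
    induction i using Fin.lastCases with
    | last => rw [hw2]; omega
    | cast i => rw [hw1]; have := hmem i; omega
  have hinj : Function.Injective w := by
    intro i j hij
    induction i using Fin.lastCases with
    | last =>
      induction j using Fin.lastCases with
      | last => rfl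
      | cast j => have := hwpos j; rw [← hij, hw3] at this; omega
    | cast i =>
      induction j using Fin.lastCases with
      | last => have := hwpos i; rw [hij, hw3] at this; omega
      | cast j => rw [hmono.injective hij]
  have hodd : (-1 : ℝ) ^ (m + 1) = -1 := Odd.neg_one_pow (Nat.odd_iff.2 (by omega))
  have h := twist_mul_pos_s11 hkm hZ hC hinj (ε := -1) (δ := -1)
    (by
      rw [pairProd_castSucc, mul_left_comm]
      refine mul_pos (pairProd_val_pos hmono) ?_
      rw [← hodd]
      have e : (-1 : ℝ) ^ (m + 1) = ∏ _j : Fin (m + 1), (-1 : ℝ) := by simp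
      rw [e, ← Finset.prod_mul_distrib]
      refine Finset.prod_pos fun j _ => ?_
      have : (0 : ℝ) < (w j.castSucc).val := by exact_mod_cast hwpos j
      rw [hw3]
      simpa using this)
    (fun x hx => by
      rw [Fin.prod_univ_castSucc, Fin.prod_univ_castSucc]
      simp only [hw1, hw3]
      have h1 : 0 < ∏ j : Fin m, (((g j : ℕ) : ℝ) - ((x : ℕ) : ℝ)) :=
        prod_pos_of_pairs hm _ fun t ht => sub_mul_sub_pos_of_consecutive (hpair t ht)
          (fun h => hx _ ((hw1 _).trans (Fin.ext h))) (fun h => hx _ ((hw1 _).trans (Fin.ext h)))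
      have h2 : 0 < x.val := Nat.pos_of_ne_zero fun h => hx _ (Fin.ext (hw3.trans h.symm))
      have h2' : (0 : ℝ) < x.val := by exact_mod_cast h2
      have h3 : x.val < (w (Fin.last m).castSucc).val := by
        have := x.isLt
        have : x.val ≠ (w (Fin.last m).castSucc).val := fun h => hx _ (Fin.ext h.symm)
        omega
      have h3' : (x.val : ℝ) < (w (Fin.last m).castSucc).val := by exact_mod_cast h3
      have := mul_pos (mul_pos h1 (sub_pos.2 h3')) h2'
      push_cast
      linarith)
  have e : (fun j : Fin (m + 2) =>
      if hj : j.val < m then Z (g ⟨j.val, hj⟩)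
      else if j.val = m then Z ⟨n - 1, by omega⟩
      else ((-1 : ℝ) ^ (k + m + 1)) • Z ⟨0, by omega⟩) =
      Function.update (fun j => Z (w j)) (Fin.last (m + 1))
        ((-1 : ℝ) ^ (k + m + 1) • Z (w (Fin.last (m + 1)))) := by
    ext j : 1
    induction j using Fin.lastCases with
    | last => simp [hw]
    | cast j =>
      rw [Function.update_of_ne (Fin.castSucc_lt_last j).ne]
      induction j using Fin.lastCases with
      | last => simp [hw]
      | cast j => simp [hw]
  have e2 : twist (C * Z) (Function.update (fun j => Z (w j)) (Fin.last (m + 1))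
      ((-1 : ℝ) ^ (k + m + 1) • Z (w (Fin.last (m + 1))))) =
      (-1 : ℝ) ^ (k + m + 1) * twist (C * Z) fun j => Z (w j) := by
    have := (twistLinear (C * Z) (fun j => Z (w j)) (Fin.last (m + 1))).map_smul
      ((-1 : ℝ) ^ (k + m + 1)) (Z (w (Fin.last (m + 1))))
    refine this.trans ?_
    rw [smul_eq_mul]
    congr 1
    change twist (C * Z) (Function.update _ _ _) = _
    rw [Function.update_eq_self_iff.2 rfl]
  rw [e, e2, add_assoc, pow_add, hodd, mul_comm _ (-1 : ℝ)]
  exact h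

lemma pluck_eq_det {k n : ℕ} (C : Matrix (Fin k) (Fin n) ℝ) (a : Fin k ↪o Fin n) :
    ∃ (S : Finset (Fin n)) (h : S.card = k), pluck C S h = (C.submatrix id a).det := by
  have hs : (Finset.univ.image a).card = k := by
    rw [Finset.card_image_of_injective _ a.injective]; simp
  refine ⟨_, hs, ?_⟩
  have e := Finset.orderEmbOfFin_unique hs (f := a) (by simp) a.strictMono
  simp only [pluck, Finset.coe_orderIsoOfFin_apply, ← e]

lemma det_mul_eq_sum {k n : ℕ} (C : Matrix (Fin k) (Fin n) ℝ) (B : Matrix (Fin n) (Fin k) ℝ) :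
    (C * B).det = ∑ a : Fin k ↪o Fin n, (C.submatrix id a).det * (B.submatrix a id).det := by
  have h := alternating_sum_smul_eq (Matrix.detRowAlternating (n := Fin k) (R := ℝ)) C
    (fun j => B j)
  have e : (fun i => ∑ j, C i j • (B j : Fin k → ℝ)) = fun i => (C * B) i := by
    ext i t
    simp [Matrix.mul_apply]
  rw [e] at h
  exact h

/-- Multiplication by the Cauchy kernel makes totally nonnegative points totally positive. -/
lemma det_mul_cauchyKernel_pos {k n : ℕ} {C : Matrix (Fin k) (Fin n) ℝ}
    (hC : LinearIndependent ℝ (fun i => C i))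
    (hnn : ∀ (S : Finset (Fin n)) (h : S.card = k), 0 ≤ pluck C S h) {s : ℝ} (hs : 1 < s)
    (a : Fin k ↪o Fin n) : 0 < ((C * cauchyKernel n s).submatrix id a).det := by
  have hnn' : ∀ b : Fin k ↪o Fin n, 0 ≤ (C.submatrix id b).det := fun b => by
    obtain ⟨S, h, e⟩ := pluck_eq_det C b
    exact e ▸ hnn S h
  have e : (C * cauchyKernel n s).submatrix id a = C * (cauchyKernel n s).submatrix id a := by
    ext i j
    simp [Matrix.mul_apply]
  rw [e, det_mul_eq_sum]
  have hpos : ∀ b : Fin k ↪o Fin n,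
      0 < (((cauchyKernel n s).submatrix id a).submatrix b id).det := fun b =>
    det_cauchyKernel_submatrix_pos hs b a
  refine Finset.sum_pos' (fun b _ => mul_nonneg (hnn' b) (hpos b).le) ?_
  by_contra! hall
  have hzero : ∀ b : Fin k ↪o Fin n, (C.submatrix id b).det = 0 := fun b => by
    have h1 := hall b (Finset.mem_univ b)
    by_contra hne
    exact h1.not_gt (mul_pos (lt_of_le_of_ne (hnn' b) (Ne.symm hne)) (hpos b))
  have hdet : (C * C.transpose).det = 0 := by
    rw [det_mul_eq_sum]
    exact Finset.sum_eq_zero fun b _ => by rw [hzero b, zero_mul]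
  rw [← Matrix.exists_vecMul_eq_zero_iff] at hdet
  obtain ⟨v, hv, hv0⟩ := hdet
  have h1 : Matrix.vecMul v C = 0 := by
    rwa [← Matrix.conjTranspose_eq_transpose_of_trivial,
      Matrix.vecMul_self_mul_conjTranspose_eq_zero] at hv0
  apply hv
  have := Fintype.linearIndependent_iff.1 hC v (by
    rw [← h1]
    ext j
    simp [Matrix.vecMul, dotProduct])
  exact funext this

/-- If some twistor coordinate of `Y` is nonzero then the rows of `Y` are independent. -/
lemma linearIndependent_of_twist_ne_zero {k m : ℕ} {Y : Matrix (Fin k) (Fin (k + m)) ℝ}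
    {u : Fin m → Fin (k + m) → ℝ} (h : twist Y u ≠ 0) :
    LinearIndependent ℝ (fun i => Y i) := by
  have h1 := (Matrix.linearIndependent_rows_of_det_ne_zero h).comp (Fin.castAdd m)
    (Fin.castAdd_injective k m)
  have e : ∀ i, Matrix.of (Fin.append (fun i => Y i) u) (Fin.castAdd m i) = Y i :=
    Fin.append_left _ _
  simpa only [Function.comp_def, e] using h1

/-- Membership in the closure of a subset of the Grassmannian, tested on a path of matrices. -/
lemma grMk_mem_closure {k p : ℕ} {D : Matrix (Fin k) (Fin p) ℝ}
    (hD : LinearIndependent ℝ (fun i => D i)) {F : ℝ → Matrix (Fin k) (Fin p) ℝ}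
    (hF : Filter.Tendsto F Filter.atTop (nhds D)) {S : Set (Gr k p)}
    (hS : ∀ s, 1 < s → ∃ h : LinearIndependent ℝ (fun i => F s i), grMk (F s) h ∈ S) :
    grMk D hD ∈ closure S := by
  rw [mem_closure_iff]
  intro O hO hmem
  have hpre : IsOpen (Quotient.mk (grSetoid k p) ⁻¹' O) := hO.preimage continuous_quotient_mk'
  obtain ⟨U, hU, hUO⟩ := isOpen_induced_iff.1 hpre
  have hDU : D ∈ U := by
    have : (⟨D, hD⟩ : FullRk k p) ∈ Quotient.mk (grSetoid k p) ⁻¹' O := hmem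
    rw [← hUO] at this
    exact this
  obtain ⟨s, hsU, hs⟩ := ((hF.eventually_mem (hU.mem_nhds hDU)).and
    (Filter.eventually_gt_atTop 1)).exists
  obtain ⟨h, hmemS⟩ := hS s hs
  refine ⟨_, ?_, hmemS⟩
  have : (⟨F s, h⟩ : FullRk k p) ∈ Quotient.mk (grSetoid k p) ⁻¹' O := by
    rw [← hUO]
    exact hsU
  exact this

/-- The amplituhedron is contained in the closure of the locus cut out by the
fixed-sign conditions of Lemma `stmt9` together with the sign-flip count
`var = k`. -/
theorem stmt11 (k m n : ℕ) (hk : 1 ≤ k) (hm : 1 ≤ m) (hkm : k + m ≤ n)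
    (Z : Matrix (Fin n) (Fin (k + m)) ℝ) (hZ : posMaxMinors Z)
    (A : Set (Gr k (k + m)))
    (hA : A = {P | ∃ (C : Matrix (Fin k) (Fin n) ℝ)
        (hC : LinearIndependent ℝ (fun i => C i)),
        (∀ (S : Finset (Fin n)) (h : S.card = k), 0 ≤ pluck C S h) ∧
        ∃ (E : Matrix (Fin k) (Fin (k + m)) ℝ)
          (hE : LinearIndependent ℝ (fun i => E i)),
          grMk E hE = P ∧
          Submodule.span ℝ (Set.range (fun i => E i)) =
            Submodule.span ℝ (Set.range (fun i => (C * Z) i))}) :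
    A ⊆ closure {P : Gr k (k + m) |
      ∃ (Y : Matrix (Fin k) (Fin (k + m)) ℝ)
        (hY : LinearIndependent ℝ (fun i => Y i)),
        grMk Y hY = P ∧

        (∀ _hme : m % 2 = 0,
          (∀ g : Fin m → Fin n, StrictMono g →
            (∀ t : Fin (m / 2),
              (g ⟨2 * t.val + 1, by have := t.isLt; omega⟩).val
                = (g ⟨2 * t.val, by have := t.isLt; omega⟩).val + 1) →
            0 < twist Y (fun j => Z (g j))) ∧
          (∀ g : Fin (m - 2) → Fin n, StrictMono g →
            (∀ t : Fin (m / 2 - 1),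
              (g ⟨2 * t.val + 1, by have := t.isLt; omega⟩).val
                = (g ⟨2 * t.val, by have := t.isLt; omega⟩).val + 1) →
            (∀ t : Fin (m - 2), 1 ≤ (g t).val ∧ (g t).val ≤ n - 2) →
            0 < twist Y (fun j =>
              if hj : j.val < m - 2 then Z (g ⟨j.val, hj⟩)
              else if j.val = m - 2 then Z ⟨n - 1, by omega⟩
              else ((-1 : ℝ) ^ (k + m - 1)) • Z ⟨0, by omega⟩))) ∧
        (∀ _hmo : m % 2 = 1,
          (∀ g : Fin m → Fin n, StrictMono g →
            (g ⟨0, by omega⟩).val = 0 →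
            (∀ t : Fin (m / 2),
              (g ⟨2 * t.val + 2, by have := t.isLt; omega⟩).val
                = (g ⟨2 * t.val + 1, by have := t.isLt; omega⟩).val + 1) →
            0 < (-1 : ℝ) ^ k * twist Y (fun j => Z (g j))) ∧
          (∀ g : Fin m → Fin n, StrictMono g →
            (g ⟨m - 1, by omega⟩).val = n - 1 →
            (∀ t : Fin (m / 2),
              (g ⟨2 * t.val + 1, by have := t.isLt; omega⟩).val
                = (g ⟨2 * t.val, by have := t.isLt; omega⟩).val + 1) →
            0 < twist Y (fun j => Z (g j)))) ∧
        signChanges (fun j : Fin (n - m + 1) =>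
          twist Y (fun t : Fin m =>
            if _ht : t.val < m - 1 then Z ⟨t.val, by omega⟩
            else Z ⟨m - 1 + j.val, by have := j.isLt; omega⟩)) = k} := by
  subst hA
  rintro _ ⟨C, hC, hnn, E, hE, rfl, hspan⟩
  have hCZ : LinearIndependent ℝ (fun i => (C * Z) i) := by
    rw [linearIndependent_iff_card_eq_finrank_span] at hE ⊢
    rw [hE, Set.finrank, Set.finrank, hspan]
  have hP : grMk E hE = grMk (C * Z) hCZ := Quotient.sound hspan
  rw [hP]
  refine grMk_mem_closure hCZ (F := fun s => C * cauchyKernel n s * Z) ?_ fun s hs => ?_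
  · have hcont : Continuous fun M : Matrix (Fin n) (Fin n) ℝ => C * M * Z := by fun_prop
    simpa [Function.comp_def] using (hcont.tendsto 1).comp (tendsto_cauchyKernel n)
  have hpos := det_mul_cauchyKernel_pos hC hnn hs
  generalize C * cauchyKernel n s = C' at hpos ⊢
  have hne := twist_initial_ne_zero hkm hZ hpos
  have hY := linearIndependent_of_twist_ne_zero hne
  refine ⟨hY, C' * Z, hY, rfl, fun hme => ⟨fun g hg hpair => ?_, fun g hg hpair hmem => ?_⟩,
    fun hmo => ⟨fun g hg h0 hpair => ?_, fun g hg hlast hpair => ?_⟩,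
    signChanges_twist_eq hk hm hkm hZ hpos hne⟩
  · exact twist_pos_of_pairs hkm hZ hpos hg hme fun t ht => hpair ⟨t, by omega⟩
  · obtain ⟨q, rfl⟩ : ∃ q, m = q + 2 := ⟨m - 2, by omega⟩
    exact twist_pos_of_pairs_wrap hkm hZ hpos hg (by omega)
      (fun t ht => hpair ⟨t, by omega⟩) hmem
  · obtain ⟨q, rfl⟩ : ∃ q, m = q + 1 := ⟨m - 1, by omega⟩
    exact twist_pos_of_first_pairs hkm hZ hpos hg (by omega) h0
      fun t ht => hpair ⟨t, by omega⟩
  · obtain ⟨q, rfl⟩ : ∃ q, m = q + 1 := ⟨m - 1, by omega⟩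
    exact twist_pos_of_pairs_last hkm hZ hpos hg (by omega) hlast
      fun t ht => hpair ⟨t, by omega⟩
end
end

section
/- Let p ≤ n and let Z be a real n×p matrix with rows Z_1,…,Z_n all of whose p×p minors are positive. Then the n×p matrix with rows Z_2, Z_3, …, Z_n, (−1)^{p−1} Z_1 also has all of its p×p minors positive (the twisted cyclic symmetry of Mat^{>0}_{n,p}). -/
noncomputable section

/-- Maximal minors may be indexed by strictly increasing row selections. -/
theorem posMaxMinors_iff_strictMono {n p : ℕ} (Z : Matrix (Fin n) (Fin p) ℝ) :
    posMaxMinors Z ↔ ∀ f : Fin p → Fin n, StrictMono f → 0 < (Z.submatrix f id).det := by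
  constructor
  · intro hZ f hf
    have hcard : (Finset.univ.image f).card = p := by
      rw [Finset.card_image_of_injective _ hf.injective, Finset.card_univ, Fintype.card_fin]
    have hfe : f = (Finset.univ.image f).orderEmbOfFin hcard :=
      Finset.orderEmbOfFin_unique hcard (fun t => Finset.mem_image_of_mem f (Finset.mem_univ t)) hf
    have hpos := hZ _ hcard
    simp only [Finset.coe_orderIsoOfFin_apply] at hpos
    rwa [← hfe] at hpos
  · intro hZ S h
    exact hZ _ fun a b hab => (S.orderIsoOfFin h).strictMono hab

theorem strictMono_cons_zero_succ {m q : ℕ} {g : Fin q → Fin m} (hg : StrictMono g) :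
    StrictMono (Fin.cons 0 (fun t => (g t).succ) : Fin (q + 1) → Fin (m + 1)) := by
  intro a b hab
  induction b using Fin.cases with
  | zero => exact absurd hab (Fin.not_lt_zero a)
  | succ b =>
    induction a using Fin.cases with
    | zero => simp
    | succ a => simpa using hg (Fin.succ_lt_succ_iff.mp hab)

/-- Moving the first row to the last place and scaling it by `(-1) ^ q` preserves the
determinant of a square matrix of size `q + 1`. -/
theorem det_snoc_neg_one_pow_smul {q : ℕ} (v : Fin (q + 1) → ℝ)
    (B : Fin q → Fin (q + 1) → ℝ) :
    (Matrix.of (Fin.snoc B ((-1 : ℝ) ^ q • v) : Fin (q + 1) → Fin (q + 1) → ℝ)).det =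
      (Matrix.of (Fin.cons v B : Fin (q + 1) → Fin (q + 1) → ℝ)).det := by
  set C : Matrix (Fin (q + 1)) (Fin (q + 1)) ℝ := Matrix.of (Fin.cons v B)
  have hrot : (C.submatrix (finRotate (q + 1)) id).updateRow (Fin.last q) v =
      C.submatrix (finRotate (q + 1)) id := by
    ext i j
    induction i using Fin.lastCases with
    | last => simp [C]
    | cast i => simp [C, Matrix.updateRow_apply, Fin.castSucc_ne_last]
  have hsnoc : (Matrix.of (Fin.snoc B ((-1 : ℝ) ^ q • v) :
      Fin (q + 1) → Fin (q + 1) → ℝ)) =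
      (C.submatrix (finRotate (q + 1)) id).updateRow (Fin.last q) ((-1 : ℝ) ^ q • v) := by
    ext i j
    induction i using Fin.lastCases with
    | last => simp
    | cast i => simp [C, Matrix.updateRow_apply, Fin.castSucc_ne_last]
  rw [hsnoc, Matrix.det_updateRow_smul, hrot, Matrix.det_permute, sign_finRotate]
  simp [← mul_assoc, ← mul_pow]

/-- Twisted cyclic symmetry: if all maximal minors of `Z` are positive, the
same holds for the matrix with rows `Z_2, ..., Z_n, (-1)^(p-1) Z_1`. -/
theorem stmt12 (n p : ℕ) (hpn : p ≤ n)
    (Z : Matrix (Fin n) (Fin p) ℝ) (hZ : posMaxMinors Z) :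
    posMaxMinors (Matrix.of (fun i : Fin n =>
      if h : i.val < n - 1 then Z ⟨i.val + 1, by omega⟩
      else ((-1 : ℝ) ^ (p - 1)) • Z ⟨0, i.pos⟩)) := by
  rw [posMaxMinors_iff_strictMono] at hZ ⊢
  intro f hf
  by_cases hlast : ∀ t, (f t).val < n - 1
  · have hpos := hZ (fun t => ⟨(f t).val + 1, by have := hlast t; omega⟩)
      fun a b hab => Nat.succ_lt_succ (hf hab)
    convert hpos using 2
    ext t j
    simp [hlast t]
  · push Not at hlast
    obtain ⟨t, ht⟩ := hlast
    obtain ⟨m, rfl⟩ : ∃ m, n = m + 1 := ⟨n - 1, by have := (f t).isLt; omega⟩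
    obtain ⟨q, rfl⟩ : ∃ q, p = q + 1 := ⟨p - 1, by have := t.isLt; omega⟩
    have hinit : ∀ s : Fin q, (f s.castSucc).val < m := fun s => by
      have h1 : (f s.castSucc).val < (f (Fin.last q)).val := hf (Fin.castSucc_lt_last s)
      have h2 := (f (Fin.last q)).isLt
      omega
    have hend : ¬ (f (Fin.last q)).val < m := by
      have h1 : (f t).val ≤ (f (Fin.last q)).val := hf.monotone (Fin.le_last t)
      simp only [Nat.add_sub_cancel] at ht
      omega
    let g : Fin q → Fin m := fun s => ⟨(f s.castSucc).val, hinit s⟩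
    have hg : StrictMono g := fun a b hab => hf (Fin.castSucc_lt_castSucc_iff.mpr hab)
    have hpos := hZ _ (strictMono_cons_zero_succ hg)
    have hcons : Z.submatrix (Fin.cons 0 (fun s => (g s).succ)) id =
        Matrix.of (Fin.cons (Z 0) (fun s => Z (g s).succ)) := by
      ext i j
      induction i using Fin.cases <;> simp
    rw [hcons, ← det_snoc_neg_one_pow_smul] at hpos
    convert hpos using 2
    ext i j
    induction i using Fin.lastCases with
    | last => simp [hend]
    | cast i => simp [hinit i, g, Fin.succ]
end
end
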